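/- arXiv:1908.05112 — 14 statements merged into one kernel-verified Lean document; each statement's English description precedes it below -/
import Mathlib

section
/- Let n ≥ 2 and let α = (α₀,…,αₙ) ∈ ℝ^{n+1} be nonzero. There exists x = (x₀,…,xₙ) ∈ ℝ^{n+1} with q₁(x) < 0, x₀ > 0 and α₀x₀ + α₁x₁ + ⋯ + αₙxₙ = 0 if and only if −α₀² + α₁² + ⋯ + αₙ² > 0. -/
/-- The quadratic form `q₁(x) = -x₀² + x₁² + ⋯ + xₙ²` on `ℝ^{n+1}`. -/
noncomputable def q1 {n : ℕ} (x : Fin (n + 1) → ℝ) : ℝ :=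
  ∑ i, x i ^ 2 - 2 * x 0 ^ 2

theorem q1_eq_sum_succ {n : ℕ} (x : Fin (n + 1) → ℝ) :
    q1 x = ∑ i : Fin n, x i.succ ^ 2 - x 0 ^ 2 := by
  rw [q1, Fin.sum_univ_succ]
  ring

/-- A hyperplane of the projective sphere, determined by a nonzero covector `α`, meets
hyperbolic space `Hⁿ = {[x] : q₁(x) < 0, x₀ > 0}` if and only if `q₁(α) > 0`. -/
theorem hyperplane_meets_hyperbolic_iff (n : ℕ) (hn : 2 ≤ n)
    (α : Fin (n + 1) → ℝ) (hα : α ≠ 0) :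
    (∃ x : Fin (n + 1) → ℝ, q1 x < 0 ∧ 0 < x 0 ∧ (∑ i, α i * x i) = 0) ↔ 0 < q1 α := by
  simp only [q1_eq_sum_succ, Fin.sum_univ_succ (n := n), sub_pos, sub_neg]
  have hS : 0 ≤ ∑ i : Fin n, α i.succ ^ 2 := Finset.sum_nonneg fun i _ => sq_nonneg _
  constructor
  · rintro ⟨x, hx, hx0, hsum⟩
    have hcs := Finset.sum_mul_sq_le_sq_mul_sq Finset.univ
      (fun i : Fin n => α i.succ) (fun i => x i.succ)
    rw [eq_neg_of_add_eq_zero_right hsum, neg_sq, mul_pow] at hcs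
    have hx0sq : 0 < x 0 ^ 2 := by positivity
    rcases hS.eq_or_lt with hS0 | hSpos
    · refine absurd (funext fun i => ?_) hα
      rw [← hS0, zero_mul] at hcs
      have h0 : α 0 ^ 2 ≤ 0 := nonpos_of_mul_nonpos_left hcs hx0sq
      refine Fin.cases ?_ (fun j => ?_) i
      · exact pow_eq_zero_iff two_ne_zero |>.mp (le_antisymm h0 (sq_nonneg _))
      · exact pow_eq_zero_iff two_ne_zero |>.mp
          ((Finset.sum_eq_zero_iff_of_nonneg fun k _ => sq_nonneg _).mp hS0.symm j
            (Finset.mem_univ j))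
    · exact lt_of_mul_lt_mul_right (hcs.trans_lt (mul_lt_mul_of_pos_left hx hSpos)) hx0sq.le
  · intro h
    have hSpos := (sq_nonneg (α 0)).trans_lt h
    refine ⟨Fin.cons (∑ i : Fin n, α i.succ ^ 2) fun i => -α 0 * α i.succ, ?_, ?_, ?_⟩
    · simp only [Fin.cons_zero, Fin.cons_succ, mul_pow, neg_sq, ← Finset.mul_sum]
      rw [sq (∑ i : Fin n, α i.succ ^ 2)]
      exact mul_lt_mul_of_pos_right h hSpos
    · simpa only [Fin.cons_zero] using hSpos
    · simp only [Fin.cons_zero, Fin.cons_succ, Finset.mul_sum, ← Finset.sum_add_distrib]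
      exact Finset.sum_eq_zero fun i _ => by ring
end

section
/- Let n ≥ 2 and let α ∈ ℝ^{n+1} be nonzero. Then: (i) there exists x ∈ ℝ^{n+1} with ⟨α,x⟩ = 0 and q₋₁(x) < 0 (every hyperplane meets Anti-de Sitter space); (ii) if q₋₁(α) < 0 (evaluated on the coordinates of α) then the set {x ∈ ℝ^{n+1} : ⟨α,x⟩ = 0 and q₋₁(x) < 0} has exactly two connected components; (iii) if q₋₁(α) > 0 then this set is connected (and nonempty). -/
/-- The quadratic form `q₋₁(x) = -x₀² + x₁² + ⋯ + x_{n-1}² - xₙ²` on `ℝ^{n+1}`. -/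
noncomputable def qm1 {n : ℕ} (x : Fin (n + 1) → ℝ) : ℝ :=
  ∑ i, x i ^ 2 - 2 * x 0 ^ 2 - 2 * x (Fin.last n) ^ 2

namespace AntiDeSitter

open Finset

variable {n : ℕ}

/-- The indices of the positive directions of `qm1`. -/
def middle (n : ℕ) : Finset (Fin (n + 1)) := (univ.erase 0).erase (Fin.last n)

lemma ne_zero_of_mem_middle {i : Fin (n + 1)} (hi : i ∈ middle n) : i ≠ 0 := by
  simp only [middle, mem_erase] at hi
  exact hi.2.1

lemma ne_last_of_mem_middle {i : Fin (n + 1)} (hi : i ∈ middle n) : i ≠ Fin.last n := by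
  simp only [middle, mem_erase] at hi
  exact hi.1

lemma last_ne_zero (hn : 2 ≤ n) : Fin.last n ≠ 0 := by
  intro h
  have := congrArg Fin.val h
  simp at this
  omega

lemma sum_eq_add_sum_middle (hn : 2 ≤ n) (f : Fin (n + 1) → ℝ) :
    ∑ i, f i = f 0 + f (Fin.last n) + ∑ i ∈ middle n, f i := by
  have hl : Fin.last n ∈ (univ : Finset (Fin (n + 1))).erase 0 := by
    simp [last_ne_zero hn]
  rw [middle, add_assoc, add_sum_erase _ f hl, add_sum_erase _ f (mem_univ 0)]

lemma qm1_eq (hn : 2 ≤ n) (x : Fin (n + 1) → ℝ) :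
    qm1 x = ∑ i ∈ middle n, x i ^ 2 - x 0 ^ 2 - x (Fin.last n) ^ 2 := by
  rw [qm1, sum_eq_add_sum_middle hn]
  ring

/-- The symmetric bilinear form associated with `qm1`. -/
noncomputable def bilin (x y : Fin (n + 1) → ℝ) : ℝ :=
  ∑ i ∈ middle n, x i * y i - x 0 * y 0 - x (Fin.last n) * y (Fin.last n)

lemma qm1_combination (hn : 2 ≤ n) (s t : ℝ) (x y : Fin (n + 1) → ℝ) :
    qm1 (s • x + t • y) = s ^ 2 * qm1 x + t ^ 2 * qm1 y + 2 * (s * t) * bilin x y := by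
  have h : ∑ i ∈ middle n, (s * x i + t * y i) ^ 2 = s ^ 2 * ∑ i ∈ middle n, x i ^ 2 +
      t ^ 2 * ∑ i ∈ middle n, y i ^ 2 + 2 * (s * t) * ∑ i ∈ middle n, x i * y i := by
    simp only [mul_sum, ← sum_add_distrib]
    exact sum_congr rfl fun i _ => by ring
  simp only [qm1_eq hn, bilin, Pi.add_apply, Pi.smul_apply, smul_eq_mul, h]
  ring

/-- The part of the hyperplane `⟨α, x⟩ = 0` inside Anti-de Sitter space. -/
def hyperplane (α : Fin (n + 1) → ℝ) : Set (Fin (n + 1) → ℝ) :=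
  {x | (∑ i, α i * x i) = 0 ∧ qm1 x < 0}

lemma joinedIn_hyperplane (hn : 2 ≤ n) {α x y : Fin (n + 1) → ℝ} (hx : x ∈ hyperplane α)
    (hy : y ∈ hyperplane α) (hxy : bilin x y ≤ 0) : JoinedIn (hyperplane α) x y := by
  refine JoinedIn.of_segment_subset ?_
  rintro _ ⟨s, t, hs, ht, hst, rfl⟩
  refine ⟨?_, ?_⟩
  · have h : ∑ i, α i * (s • x + t • y) i = s * ∑ i, α i * x i + t * ∑ i, α i * y i := by
      simp only [mul_sum, ← sum_add_distrib, Pi.add_apply, Pi.smul_apply, smul_eq_mul]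
      exact sum_congr rfl fun i _ => by ring
    rw [h, hx.1, hy.1]
    simp
  · rw [qm1_combination hn]
    have h1 : s * t * bilin x y ≤ 0 := mul_nonpos_of_nonneg_of_nonpos (mul_nonneg hs ht) hxy
    have h2 : t ^ 2 * qm1 y ≤ 0 := mul_nonpos_of_nonneg_of_nonpos (sq_nonneg t) hy.2.le
    have h3 : s ^ 2 * qm1 x ≤ 0 := mul_nonpos_of_nonneg_of_nonpos (sq_nonneg s) hx.2.le
    rcases hs.eq_or_lt with rfl | hs
    · obtain rfl : t = 1 := by linarith
      have := hy.2
      linarith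
    · have : s ^ 2 * qm1 x < 0 := mul_neg_of_pos_of_neg (by positivity) hx.2
      linarith

/-- The vector with prescribed negative coordinates `u`, `v` and positive coordinates `w`. -/
def ofCoords (u v : ℝ) (w : Fin (n + 1) → ℝ) : Fin (n + 1) → ℝ :=
  fun i => if i = 0 then u else if i = Fin.last n then v else w i

@[simp] lemma ofCoords_zero (u v : ℝ) (w : Fin (n + 1) → ℝ) : ofCoords u v w 0 = u := by
  simp [ofCoords]

lemma ofCoords_last (hn : 2 ≤ n) (u v : ℝ) (w : Fin (n + 1) → ℝ) :
    ofCoords u v w (Fin.last n) = v := by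
  simp [ofCoords, last_ne_zero hn]

lemma ofCoords_middle (u v : ℝ) (w : Fin (n + 1) → ℝ) {i : Fin (n + 1)} (hi : i ∈ middle n) :
    ofCoords u v w i = w i := by
  simp [ofCoords, ne_zero_of_mem_middle hi, ne_last_of_mem_middle hi]

lemma sum_mul_ofCoords (hn : 2 ≤ n) (α : Fin (n + 1) → ℝ) (u v : ℝ) (w : Fin (n + 1) → ℝ) :
    ∑ i, α i * ofCoords u v w i =
      α 0 * u + α (Fin.last n) * v + ∑ i ∈ middle n, α i * w i := by
  rw [sum_eq_add_sum_middle hn, ofCoords_zero, ofCoords_last hn]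
  congr 1
  exact sum_congr rfl fun i hi => by rw [ofCoords_middle _ _ _ hi]

lemma qm1_ofCoords (hn : 2 ≤ n) (u v : ℝ) (w : Fin (n + 1) → ℝ) :
    qm1 (ofCoords u v w) = ∑ i ∈ middle n, w i ^ 2 - u ^ 2 - v ^ 2 := by
  rw [qm1_eq hn, ofCoords_zero, ofCoords_last hn]
  congr 2
  exact sum_congr rfl fun i hi => by rw [ofCoords_middle _ _ _ hi]

lemma bilin_ofCoords (hn : 2 ≤ n) (x : Fin (n + 1) → ℝ) (u v : ℝ) (w : Fin (n + 1) → ℝ) :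
    bilin x (ofCoords u v w) =
      ∑ i ∈ middle n, x i * w i - x 0 * u - x (Fin.last n) * v := by
  rw [bilin, ofCoords_zero, ofCoords_last hn]
  congr 2
  exact sum_congr rfl fun i hi => by rw [ofCoords_middle _ _ _ hi]

lemma hyperplane_nonempty (hn : 2 ≤ n) (α : Fin (n + 1) → ℝ) : (hyperplane α).Nonempty := by
  by_cases h : α 0 = 0 ∧ α (Fin.last n) = 0
  · refine ⟨ofCoords 1 0 0, ?_, ?_⟩
    · simp [sum_mul_ofCoords hn, h.1]
    · simp [qm1_ofCoords hn]
  · refine ⟨ofCoords (-α (Fin.last n)) (α 0) 0, ?_, ?_⟩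
    · simp only [sum_mul_ofCoords hn, Pi.zero_apply, mul_zero, sum_const_zero]
      ring
    · simp only [qm1_ofCoords hn, Pi.zero_apply]
      rw [not_and_or] at h
      rcases h with h | h <;> have := sq_pos_of_ne_zero h <;> norm_num
      · nlinarith [sq_nonneg (α (Fin.last n))]
      · nlinarith [sq_nonneg (α 0)]

lemma card_connectedComponents_eq_two {X : Type*} [TopologicalSpace X] {f : X → ℝ}
    (hf : Continuous f) (hf0 : ∀ x, f x ≠ 0) {p q : X} (hp : 0 < f p) (hq : f q < 0)
    (hpos : ∀ x, 0 < f x → Joined x p) (hneg : ∀ x, f x < 0 → Joined x q) :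
    Nat.card (ConnectedComponents X) = 2 := by
  have hmk {x y : X} (h : Joined x y) : (x : ConnectedComponents X) = y := by
    rw [ConnectedComponents.coe_eq_coe']
    exact pathComponent_subset_component y h.symm
  rw [Nat.card_eq_two_iff]
  refine ⟨p, q, ?_, ?_⟩
  · intro h
    rw [ConnectedComponents.coe_eq_coe'] at h
    obtain ⟨x, -, hx⟩ := isPreconnected_connectedComponent.intermediate_value
      (mem_connectedComponent (x := q)) h hf.continuousOn ⟨hq.le, hp.le⟩
    exact hf0 x hx
  · refine Set.eq_univ_of_forall fun c => ?_
    obtain ⟨x, rfl⟩ := ConnectedComponents.surjective_coe c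
    rcases (hf0 x).lt_or_gt with h | h
    · exact Or.inr (hmk (hneg x h))
    · exact Or.inl (hmk (hpos x h))

lemma card_connectedComponents_hyperplane (hn : 2 ≤ n) {α : Fin (n + 1) → ℝ} (hα : qm1 α < 0) :
    Nat.card (ConnectedComponents (hyperplane α)) = 2 := by
  rw [qm1_eq hn] at hα
  have hb : 0 ≤ ∑ i ∈ middle n, α i ^ 2 := sum_nonneg fun i _ => sq_nonneg _
  let f (x : Fin (n + 1) → ℝ) : ℝ := α 0 * x (Fin.last n) - α (Fin.last n) * x 0
  let p (c : ℝ) : Fin (n + 1) → ℝ := ofCoords (-(c * α (Fin.last n))) (c * α 0) 0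
  have hfp (c : ℝ) : f (p c) = c * (α 0 ^ 2 + α (Fin.last n) ^ 2) := by
    simp only [f, p, ofCoords_zero, ofCoords_last hn]
    ring
  have hp (c : ℝ) (hc : c ^ 2 = 1) : p c ∈ hyperplane α := by
    refine ⟨?_, ?_⟩
    · simp only [p, sum_mul_ofCoords hn, Pi.zero_apply, mul_zero, sum_const_zero]
      ring
    · simp only [p, qm1_ofCoords hn, Pi.zero_apply, neg_sq, mul_pow, hc]
      norm_num
      linarith
  have hbilin (c : ℝ) (x : Fin (n + 1) → ℝ) : bilin x (p c) = -(c * f x) := by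
    simp only [p, f, bilin_ofCoords hn, Pi.zero_apply, mul_zero, sum_const_zero]
    ring
  have hf : Continuous fun x : hyperplane α => f x :=
    (show Continuous f by fun_prop).comp continuous_subtype_val
  refine card_connectedComponents_eq_two hf (p := ⟨p 1, hp 1 (by norm_num)⟩)
    (q := ⟨p (-1), hp (-1) (by norm_num)⟩) ?_ ?_ ?_ ?_ ?_
  · rintro ⟨x, hx, hqx⟩ h0
    simp only [f] at h0
    rw [sum_eq_add_sum_middle hn] at hx
    rw [qm1_eq hn] at hqx
    have hcs := sum_mul_sq_le_sq_mul_sq (middle n) α x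
    have hy : 0 ≤ ∑ i ∈ middle n, x i ^ 2 := sum_nonneg fun i _ => sq_nonneg _
    have hid : (α 0 ^ 2 + α (Fin.last n) ^ 2) * (x 0 ^ 2 + x (Fin.last n) ^ 2) =
        (∑ i ∈ middle n, α i * x i) ^ 2 := by
      have : ∑ i ∈ middle n, α i * x i =
        -(α 0 * x 0 + α (Fin.last n) * x (Fin.last n)) := by linarith
      rw [this]
      linear_combination
        (α 0 * x (Fin.last n) - α (Fin.last n) * x 0) * h0
    have : (∑ i ∈ middle n, α i ^ 2) * ∑ i ∈ middle n, x i ^ 2 <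
        (α 0 ^ 2 + α (Fin.last n) ^ 2) * (x 0 ^ 2 + x (Fin.last n) ^ 2) :=
      mul_lt_mul'' (by linarith) (by linarith) hb hy
    linarith
  · simp only [hfp]
    linarith
  · simp only [hfp]
    linarith
  · rintro ⟨x, hx⟩ h
    refine (joinedIn_hyperplane hn hx (hp 1 (by norm_num)) ?_).joined_subtype
    rw [hbilin]
    simp only at h
    linarith
  · rintro ⟨x, hx⟩ h
    refine (joinedIn_hyperplane hn hx (hp (-1) (by norm_num)) ?_).joined_subtype
    rw [hbilin]
    simp only at h
    linarith

lemma isPathConnected_hyperplane (hn : 2 ≤ n) {α : Fin (n + 1) → ℝ} (hα : 0 < qm1 α) :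
    IsPathConnected (hyperplane α) := by
  rw [qm1_eq hn] at hα
  set β := ∑ i ∈ middle n, α i ^ 2 with hβ
  have hβ0 : 0 < β := by nlinarith [sq_nonneg (α 0), sq_nonneg (α (Fin.last n))]
  let k (z : ℝ × ℝ) : ℝ := -(α 0 * z.1 + α (Fin.last n) * z.2) / β
  have hk (z : ℝ × ℝ) : k z * β = -(α 0 * z.1 + α (Fin.last n) * z.2) :=
    div_mul_cancel₀ _ hβ0.ne'
  let σ (z : ℝ × ℝ) : Fin (n + 1) → ℝ := ofCoords z.1 z.2 (k z • α)
  have hσc : Continuous σ := by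
    refine continuous_pi fun i => ?_
    simp only [σ, ofCoords, k, Pi.smul_apply, smul_eq_mul]
    split_ifs <;> fun_prop
  have hσ (z : ℝ × ℝ) (hz : z ≠ 0) : σ z ∈ hyperplane α := by
    have hz2 : 0 < z.1 ^ 2 + z.2 ^ 2 := by
      by_contra! h
      exact hz (Prod.ext (by simp; nlinarith [sq_nonneg z.1, sq_nonneg z.2])
        (by simp; nlinarith [sq_nonneg z.1, sq_nonneg z.2]))
    refine ⟨?_, ?_⟩
    · have : ∑ i ∈ middle n, α i * (k z • α) i = k z * β := by
        rw [hβ, mul_sum]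
        exact sum_congr rfl fun i _ => by simp only [Pi.smul_apply, smul_eq_mul]; ring
      rw [sum_mul_ofCoords hn, this, hk]
      ring
    · have : ∑ i ∈ middle n, (k z • α) i ^ 2 = k z ^ 2 * β := by
        rw [hβ, mul_sum]
        exact sum_congr rfl fun i _ => by simp only [Pi.smul_apply, smul_eq_mul]; ring
      rw [qm1_ofCoords hn, this]
      have h1 : (k z ^ 2 * β) * β ≤
          (α 0 ^ 2 + α (Fin.last n) ^ 2) * (z.1 ^ 2 + z.2 ^ 2) := by
        have : (k z ^ 2 * β) * β = (k z * β) ^ 2 := by ring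
        rw [this, hk]
        nlinarith [sq_nonneg (α 0 * z.2 - α (Fin.last n) * z.1)]
      have h2 : (α 0 ^ 2 + α (Fin.last n) ^ 2) * (z.1 ^ 2 + z.2 ^ 2) <
          (z.1 ^ 2 + z.2 ^ 2) * β := by
        rw [mul_comm]
        exact mul_lt_mul_of_pos_left (by linarith) hz2
      have := lt_of_mul_lt_mul_right (h1.trans_lt h2) hβ0.le
      linarith
  have hjoin (x : Fin (n + 1) → ℝ) (hx : x ∈ hyperplane α) :
      (x 0, x (Fin.last n)) ≠ (0 : ℝ × ℝ) ∧
        JoinedIn (hyperplane α) x (σ (x 0, x (Fin.last n))) := by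
    have hqx := hx.2
    rw [qm1_eq hn] at hqx
    have hz : (x 0, x (Fin.last n)) ≠ (0 : ℝ × ℝ) := by
      intro h
      obtain ⟨h0, hl⟩ := Prod.mk.inj h
      rw [h0, hl] at hqx
      have : 0 ≤ ∑ i ∈ middle n, x i ^ 2 := sum_nonneg fun i _ => sq_nonneg _
      simp at hqx
      linarith
    refine ⟨hz, joinedIn_hyperplane hn hx (hσ _ hz) ?_⟩
    have hqσ := (hσ _ hz).2
    rw [qm1_ofCoords hn] at hqσ
    rw [bilin_ofCoords hn]
    set w := k (x 0, x (Fin.last n)) • α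
    have : 2 * ∑ i ∈ middle n, x i * w i ≤
        ∑ i ∈ middle n, x i ^ 2 + ∑ i ∈ middle n, w i ^ 2 := by
      rw [mul_sum, ← sum_add_distrib]
      exact sum_le_sum fun i _ => by linarith [two_mul_le_add_sq (x i) (w i)]
    simp only at hqσ ⊢
    nlinarith
  have hconn : IsPathConnected (σ '' {0}ᶜ) :=
    (isPathConnected_compl_singleton_of_one_lt_rank (by simp [one_add_one_eq_two]) 0).image hσc
  have hsub : σ '' {0}ᶜ ⊆ hyperplane α := by
    rintro _ ⟨z, hz, rfl⟩
    exact hσ z hz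
  refine isPathConnected_iff.2 ⟨hyperplane_nonempty hn α, fun x hx y hy => ?_⟩
  obtain ⟨hx0, hxj⟩ := hjoin x hx
  obtain ⟨hy0, hyj⟩ := hjoin y hy
  exact (hxj.trans ((hconn.joinedIn _ ⟨_, hx0, rfl⟩ _ ⟨_, hy0, rfl⟩).mono hsub)).trans hyj.symm

end AntiDeSitter

/-- Every hyperplane meets Anti-de Sitter space; it does so in two connected components
if the defining covector `α` satisfies `q₋₁(α) < 0` (spacelike hyperplane), and in a
connected nonempty set if `q₋₁(α) > 0` (timelike hyperplane). -/
theorem adS_hyperplanes (n : ℕ) (hn : 2 ≤ n) (α : Fin (n + 1) → ℝ) (hα : α ≠ 0) :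
    (∃ x : Fin (n + 1) → ℝ, (∑ i, α i * x i) = 0 ∧ qm1 x < 0) ∧
    (qm1 α < 0 →
      Nat.card (ConnectedComponents
        {x : Fin (n + 1) → ℝ // (∑ i, α i * x i) = 0 ∧ qm1 x < 0}) = 2) ∧
    (0 < qm1 α →
      IsConnected {x : Fin (n + 1) → ℝ | (∑ i, α i * x i) = 0 ∧ qm1 x < 0}) :=
  ⟨AntiDeSitter.hyperplane_nonempty hn α, AntiDeSitter.card_connectedComponents_hyperplane hn,
    fun h => (AntiDeSitter.isPathConnected_hyperplane hn h).isConnected⟩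
end

section
/- Let n ≥ 2 and let α, α′ ∈ ℝ^{n+1} be linearly independent with q₋₁(α) < 0 and q₋₁(α′) < 0. Then there exists x ∈ ℝ^{n+1} with q₋₁(x) < 0, ⟨α,x⟩ = 0 and ⟨α′,x⟩ = 0 if and only if b₋₁(α,α′)² > q₋₁(α)·q₋₁(α′). -/
/-- The bilinear form `b₋₁(x,y) = -x₀y₀ + x₁y₁ + ⋯ + x_{n-1}y_{n-1} - xₙyₙ`. -/
noncomputable def bm1 {n : ℕ} (x y : Fin (n + 1) → ℝ) : ℝ :=
  ∑ i, x i * y i - 2 * (x 0 * y 0) - 2 * (x (Fin.last n) * y (Fin.last n))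

section AdSForm

variable {n : ℕ}

theorem qm1_eq_bm1 (x : Fin (n + 1) → ℝ) : qm1 x = bm1 x x := by
  simp only [qm1, bm1, pow_two]

theorem bm1_comm (x y : Fin (n + 1) → ℝ) : bm1 x y = bm1 y x := by
  simp only [bm1, mul_comm]

theorem bm1_add_left (x y z : Fin (n + 1) → ℝ) : bm1 (x + y) z = bm1 x z + bm1 y z := by
  simp only [bm1, Pi.add_apply, add_mul, Finset.sum_add_distrib]
  ring

theorem bm1_smul_left (c : ℝ) (x y : Fin (n + 1) → ℝ) : bm1 (c • x) y = c * bm1 x y := by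
  simp only [bm1, Pi.smul_apply, smul_eq_mul, mul_assoc, ← Finset.mul_sum]
  ring

theorem bm1_add_right (x y z : Fin (n + 1) → ℝ) : bm1 x (y + z) = bm1 x y + bm1 x z := by
  rw [bm1_comm, bm1_add_left, bm1_comm y, bm1_comm z]

theorem bm1_smul_right (c : ℝ) (x y : Fin (n + 1) → ℝ) : bm1 x (c • y) = c * bm1 x y := by
  rw [bm1_comm, bm1_smul_left, bm1_comm]

/-- The linear involution changing the sign of the two negative coordinates. -/
def timeReflection (x : Fin (n + 1) → ℝ) : Fin (n + 1) → ℝ :=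
  fun i => if i = 0 ∨ i = Fin.last n then -x i else x i

theorem timeReflection_timeReflection (x : Fin (n + 1) → ℝ) :
    timeReflection (timeReflection x) = x := by
  funext i
  by_cases h : i = 0 ∨ i = Fin.last n <;> simp [timeReflection, h]

/-- A sum splits into its first and last terms and the rest. -/
theorem sum_eq_first_add_last_add_rest (hn : n ≠ 0) (f : Fin (n + 1) → ℝ) :
    ∑ i, f i = f 0 + f (Fin.last n)
      + ∑ i, if i = 0 ∨ i = Fin.last n then 0 else f i := by
  have h0 : (0 : Fin (n + 1)) ≠ Fin.last n := by
    simpa [Fin.ext_iff] using hn.symm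
  have h (i : Fin (n + 1)) : f i = ((if i = 0 then f i else 0)
      + (if i = Fin.last n then f i else 0))
      + (if i = 0 ∨ i = Fin.last n then 0 else f i) := by
    by_cases h1 : i = 0
    · subst h1
      simp [h0]
    · by_cases h2 : i = Fin.last n <;> simp [h1, h2, hn]
  rw [Finset.sum_congr rfl fun i _ => h i]
  simp [Finset.sum_add_distrib]

theorem sum_mul_timeReflection (hn : n ≠ 0) (x y : Fin (n + 1) → ℝ) :
    ∑ i, x i * timeReflection y i = bm1 x y := by
  rw [bm1, sum_eq_first_add_last_add_rest hn fun i => x i * timeReflection y i,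
    sum_eq_first_add_last_add_rest hn fun i => x i * y i]
  have h : ∀ i, (if i = 0 ∨ i = Fin.last n then 0 else x i * timeReflection y i)
      = if i = 0 ∨ i = Fin.last n then 0 else x i * y i := by
    intro i
    split_ifs with hi <;> simp [timeReflection, hi]
  simp only [h]
  simp only [timeReflection, true_or, or_true, if_true]
  ring

theorem qm1_timeReflection (hn : n ≠ 0) (x : Fin (n + 1) → ℝ) :
    qm1 (timeReflection x) = qm1 x := by
  rw [qm1_eq_bm1, qm1_eq_bm1, ← sum_mul_timeReflection hn, timeReflection_timeReflection,
    ← sum_mul_timeReflection hn]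
  simp only [mul_comm]

/-- Euclidean annihilators of two covectors correspond to their `b₋₁`-orthogonal vectors. -/
theorem exists_annihilated_iff_exists_bm1_orthogonal (hn : n ≠ 0) (α β : Fin (n + 1) → ℝ) :
    (∃ x : Fin (n + 1) → ℝ, qm1 x < 0 ∧ (∑ i, α i * x i) = 0 ∧ (∑ i, β i * x i) = 0) ↔
      ∃ y : Fin (n + 1) → ℝ, qm1 y < 0 ∧ bm1 α y = 0 ∧ bm1 β y = 0 := by
  constructor
  · rintro ⟨x, hx, h1, h2⟩
    refine ⟨timeReflection x, by rwa [qm1_timeReflection hn], ?_, ?_⟩ <;>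
      rwa [← sum_mul_timeReflection hn, timeReflection_timeReflection]
  · rintro ⟨y, hy, h1, h2⟩
    refine ⟨timeReflection y, by rwa [qm1_timeReflection hn], ?_, ?_⟩ <;>
      rwa [sum_mul_timeReflection hn]

/-- The form is positive definite on vectors whose two negative coordinates vanish. -/
theorem eq_zero_of_qm1_nonpos {v : Fin (n + 1) → ℝ} (h0 : v 0 = 0) (hl : v (Fin.last n) = 0)
    (hv : qm1 v ≤ 0) : v = 0 := by
  have hs : ∑ i, v i ^ 2 = 0 :=
    le_antisymm (by simpa [qm1, h0, hl] using hv) (Finset.sum_nonneg fun i _ => sq_nonneg (v i))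
  rw [Finset.sum_eq_zero_iff_of_nonneg fun i _ => sq_nonneg (v i)] at hs
  funext i
  simpa using hs i (Finset.mem_univ i)

/-- Among three vectors some nontrivial combination has both negative coordinates zero. -/
theorem exists_combination_negative_coords_eq_zero (x y z : Fin (n + 1) → ℝ) :
    ∃ a b c : ℝ, (a ≠ 0 ∨ b ≠ 0 ∨ c ≠ 0) ∧ (a • x + (b • y + c • z)) 0 = 0 ∧
      (a • x + (b • y + c • z)) (Fin.last n) = 0 := by
  let M : Matrix (Fin 2) (Fin 3) ℝ :=
    !![x 0, y 0, z 0; x (Fin.last n), y (Fin.last n), z (Fin.last n)]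
  have hker : LinearMap.ker M.mulVecLin ≠ ⊥ :=
    LinearMap.ker_ne_bot_of_finrank_lt (by simp)
  obtain ⟨w, hw, hw0⟩ := Submodule.exists_mem_ne_zero_of_ne_bot hker
  rw [LinearMap.mem_ker, Matrix.mulVecLin_apply] at hw
  have e0 := congrFun hw 0
  have e1 := congrFun hw 1
  simp [M, Matrix.mulVec, dotProduct, Fin.sum_univ_three] at e0 e1
  refine ⟨w 0, w 1, w 2, ?_, ?_, ?_⟩
  · by_contra! h
    apply hw0
    funext i
    fin_cases i
    exacts [h.1, h.2.1, h.2.2]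
  · simp only [Pi.add_apply, Pi.smul_apply, smul_eq_mul]
    linarith
  · simp only [Pi.add_apply, Pi.smul_apply, smul_eq_mul]
    linarith

/-- Reverse Cauchy–Schwarz inequality in the orthogonal complement of a negative vector. -/
theorem qm1_mul_qm1_lt_sq_bm1 {α β y : Fin (n + 1) → ℝ} (hli : LinearIndependent ℝ ![α, β])
    (hα : qm1 α < 0) (hy : qm1 y < 0) (hαy : bm1 α y = 0) (hβy : bm1 β y = 0) :
    qm1 α * qm1 β < bm1 α β ^ 2 := by
  by_contra! hle
  obtain ⟨a, b, c, hne, h0, hl⟩ := exists_combination_negative_coords_eq_zero y α β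
  have hq : qm1 (a • y + (b • α + c • β))
      = a ^ 2 * qm1 y + (b ^ 2 * qm1 α + 2 * (b * c) * bm1 α β + c ^ 2 * qm1 β) := by
    simp only [qm1_eq_bm1, bm1_add_left, bm1_add_right, bm1_smul_left, bm1_smul_right,
      bm1_comm y α, bm1_comm y β, bm1_comm β α, hαy, hβy]
    ring
  have hplane : b ^ 2 * qm1 α + 2 * (b * c) * bm1 α β + c ^ 2 * qm1 β ≤ 0 := by
    refine nonpos_of_mul_nonneg_right ?_ hα
    nlinarith [sq_nonneg (b * qm1 α + c * bm1 α β),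
      mul_nonneg (sq_nonneg c) (sub_nonneg.mpr hle)]
  have hay : a ^ 2 * qm1 y ≤ 0 := mul_nonpos_of_nonneg_of_nonpos (sq_nonneg a) hy.le
  have hv := eq_zero_of_qm1_nonpos h0 hl (by linarith)
  rw [hv] at hq
  have hz : qm1 (0 : Fin (n + 1) → ℝ) = 0 := by simp [qm1]
  have ha2 : a ^ 2 * qm1 y = 0 := by linarith
  have ha : a = 0 := by simpa [hy.ne] using ha2
  rw [ha, zero_smul, zero_add] at hv
  obtain ⟨hb, hc⟩ := LinearIndependent.pair_iff.mp hli b c hv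
  simp [ha, hb, hc] at hne

/-- A negative vector is orthogonal to some other negative vector. -/
theorem exists_qm1_neg_bm1_eq_zero (hn : n ≠ 0) {α : Fin (n + 1) → ℝ} (hα : qm1 α < 0) :
    ∃ u : Fin (n + 1) → ℝ, qm1 u < 0 ∧ bm1 α u = 0 := by
  have h0 : Fin.last n ≠ 0 := by simpa [Fin.ext_iff] using hn
  have hpos : 0 < α 0 ^ 2 + α (Fin.last n) ^ 2 := by
    have := Finset.sum_nonneg fun i (_ : i ∈ Finset.univ) => sq_nonneg (α i)
    unfold qm1 at hα
    linarith
  let u : Fin (n + 1) → ℝ :=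
    α (Fin.last n) • Pi.single 0 1 + (-α 0) • Pi.single (Fin.last n) 1
  have hu (x : Fin (n + 1) → ℝ) :
      bm1 x u = -(α (Fin.last n) * x 0) + α 0 * x (Fin.last n) := by
    simp only [u, bm1_add_right, bm1_smul_right]
    simp [bm1, Pi.single_apply, h0, h0.symm]
    ring
  refine ⟨u, ?_, by rw [hu]; ring⟩
  rw [qm1_eq_bm1, hu]
  simp [u, h0, h0.symm]
  nlinarith

/-- The orthogonal complement of an indefinite plane contains a negative vector. -/
theorem exists_qm1_neg_orthogonal (hn : n ≠ 0) {α β : Fin (n + 1) → ℝ} (hα : qm1 α < 0)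
    (h : qm1 α * qm1 β < bm1 α β ^ 2) :
    ∃ y : Fin (n + 1) → ℝ, qm1 y < 0 ∧ bm1 α y = 0 ∧ bm1 β y = 0 := by
  obtain ⟨u, hu, hαu⟩ := exists_qm1_neg_bm1_eq_zero hn hα
  let w := qm1 α • β + (-bm1 α β) • α
  have hαw : bm1 α w = 0 := by
    simp only [w, bm1_add_right, bm1_smul_right, qm1_eq_bm1]
    ring
  have hβw : bm1 β w = qm1 α * qm1 β - bm1 α β ^ 2 := by
    simp only [w, bm1_add_right, bm1_smul_right, qm1_eq_bm1, bm1_comm β α]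
    ring
  have hwu : bm1 w u = qm1 α * bm1 β u := by
    simp only [w, bm1_add_left, bm1_smul_left, hαu]
    ring
  have hww : bm1 w w = qm1 α * bm1 β w := by
    rw [show bm1 w w = bm1 (qm1 α • β + (-bm1 α β) • α) w from rfl, bm1_add_left,
      bm1_smul_left, bm1_smul_left, hαw]
    ring
  have hβw_neg : bm1 β w < 0 := by linarith
  have hww_pos : 0 < bm1 w w := hww ▸ mul_pos_of_neg_of_neg hα hβw_neg
  refine ⟨u + (-(bm1 w u / bm1 w w)) • w, ?_, ?_, ?_⟩
  · have hq : qm1 (u + (-(bm1 w u / bm1 w w)) • w) = qm1 u - bm1 w u ^ 2 / bm1 w w := by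
      simp only [qm1_eq_bm1, bm1_add_left, bm1_add_right, bm1_smul_left, bm1_smul_right,
        bm1_comm u w]
      field_simp
      ring
    have : 0 ≤ bm1 w u ^ 2 / bm1 w w := by positivity
    linarith
  · rw [bm1_add_right, bm1_smul_right, hαu, hαw, mul_zero, add_zero]
  · rw [bm1_add_right, bm1_smul_right, hwu, hww]
    field_simp [hα.ne, hβw_neg.ne]
    ring

end AdSForm

/-- Two spacelike hyperplanes of Anti-de Sitter space, with linearly independent defining
covectors `α, α'` satisfying `q₋₁(α), q₋₁(α') < 0`, intersect transversely in `AdSⁿ` if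
and only if `b₋₁(α,α')² > q₋₁(α)·q₋₁(α')`. -/
theorem adS_spacelike_hyperplanes_transverse_iff (n : ℕ) (hn : 2 ≤ n)
    (α α' : Fin (n + 1) → ℝ) (hli : LinearIndependent ℝ ![α, α'])
    (hα : qm1 α < 0) (hα' : qm1 α' < 0) :
    (∃ x : Fin (n + 1) → ℝ, qm1 x < 0 ∧
        (∑ i, α i * x i) = 0 ∧ (∑ i, α' i * x i) = 0)
      ↔ qm1 α * qm1 α' < (bm1 α α') ^ 2 := by
  have hn0 : n ≠ 0 := by omega
  rw [exists_annihilated_iff_exists_bm1_orthogonal hn0]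
  exact ⟨fun ⟨_, hy, hαy, hαy'⟩ => qm1_mul_qm1_lt_sq_bm1 hli hα hy hαy hαy',
    exists_qm1_neg_orthogonal hn0 hα⟩
end

section
/- Let n ≥ 3 and let α, α′ ∈ ℝ^{n+1} be linearly independent with q₋₁(α) > 0 and q₋₁(α′) > 0. Set K = {x ∈ ℝ^{n+1} : ⟨α,x⟩ = 0, ⟨α′,x⟩ = 0, q₋₁(x) < 0}. Then: (i) K is nonempty (two timelike hyperplanes of AdSⁿ always intersect in AdSⁿ); (ii) if b₋₁(α,α′)² > q₋₁(α)·q₋₁(α′) then K has exactly two connected components (spacelike intersection, a doubled copy of H^{n−2}); (iii) if b₋₁(α,α′)² < q₋₁(α)·q₋₁(α′) then K is connected (timelike intersection, a copy of AdS^{n−2}). -/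
namespace LinearMap.BilinForm

variable {V : Type*} [AddCommGroup V] [Module ℝ V] {B : LinearMap.BilinForm ℝ V} {a a' e f u x y : V}

/-- The projection of `x` onto the orthogonal complement of `a`, when `B a a ≠ 0`. -/
noncomputable def projPerp (B : LinearMap.BilinForm ℝ V) (a x : V) : V :=
  x - (B a x / B a a) • a

lemma apply_projPerp_self (ha : B a a ≠ 0) (x : V) : B a (projPerp B a x) = 0 := by
  simp [projPerp, ha]

lemma projPerp_apply_self (hB : B.IsSymm) (ha : B a a ≠ 0) (x : V) :
    B (projPerp B a x) (projPerp B a x) = B x x - B a x ^ 2 / B a a := by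
  have h := hB.eq x a
  simp only [projPerp, map_sub, map_smul, LinearMap.sub_apply, LinearMap.smul_apply, smul_eq_mul, h]
  field_simp
  ring

/-- The vectors `e` and `f` span a plane on which `B` is negative definite. -/
def SpansNegPlane (B : LinearMap.BilinForm ℝ V) (e f : V) : Prop :=
  ∀ s t : ℝ, (s ≠ 0 ∨ t ≠ 0) → B (s • e + t • f) (s • e + t • f) < 0

lemma SpansNegPlane.projPerp (hB : B.IsSymm) (ha : 0 < B a a) (h : SpansNegPlane B e f) :
    SpansNegPlane B (projPerp B a e) (projPerp B a f) := by
  intro s t hst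
  have heq : s • BilinForm.projPerp B a e + t • BilinForm.projPerp B a f
      = BilinForm.projPerp B a (s • e + t • f) := by
    simp only [BilinForm.projPerp, map_add, map_smul, smul_eq_mul]
    module
  rw [heq, projPerp_apply_self hB ha.ne']
  have := h s t hst
  have : 0 ≤ B a (s • e + t • f) ^ 2 / B a a := by positivity
  linarith

/-- The vectors with `B x x < 0` that are orthogonal to both `a` and `a'`. -/
def negPerp (B : LinearMap.BilinForm ℝ V) (a a' : V) : Set V :=
  {x | B a x = 0 ∧ B a' x = 0 ∧ B x x < 0}

lemma neg_mem_negPerp (hx : x ∈ negPerp B a a') : -x ∈ negPerp B a a' := by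
  simpa [negPerp] using hx

lemma SpansNegPlane.negPerp_nonempty (hB : B.IsSymm) (ha : 0 < B a a)
    (h : SpansNegPlane B e f) : (negPerp B a a').Nonempty := by
  have h' := h.projPerp hB ha
  set e' := BilinForm.projPerp B a e with he
  set f' := BilinForm.projPerp B a f with hf
  have h1 : B a e' = 0 := apply_projPerp_self ha.ne' e
  have h2 : B a f' = 0 := apply_projPerp_self ha.ne' f
  by_cases h0 : B a' e' = 0
  · exact ⟨e', h1, h0, by simpa using h' 1 0 (by simp)⟩
  · refine ⟨(-B a' f') • e' + B a' e' • f', by simp [h1, h2], ?_, h' _ _ (Or.inr h0)⟩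
    simp only [map_add, map_smul, smul_eq_mul]
    ring

lemma SpansNegPlane.exists_mem_negPerp (hB : B.IsSymm) (ha : 0 < B a a)
    (hdet : B a a' ^ 2 < B a a * B a' a') (h : SpansNegPlane B e f) :
    ∃ e' ∈ negPerp B a a', ∃ f' ∈ negPerp B a a', SpansNegPlane B e' f' := by
  set c := BilinForm.projPerp B a a' with hc
  have hcc : 0 < B c c := by
    rw [hc, projPerp_apply_self hB ha.ne', sub_pos, div_lt_iff₀ ha]
    linarith
  have hac : B a c = 0 := apply_projPerp_self ha.ne' a'
  have h' := (h.projPerp hB ha).projPerp hB hcc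
  have key (x : V) : B a (BilinForm.projPerp B c (BilinForm.projPerp B a x)) = 0 ∧
      B a' (BilinForm.projPerp B c (BilinForm.projPerp B a x)) = 0 := by
    set y := BilinForm.projPerp B c (BilinForm.projPerp B a x) with hy
    have h1 : B a y = 0 := by
      rw [hy, BilinForm.projPerp, map_sub, map_smul, hac, apply_projPerp_self ha.ne']
      simp
    have h2 : B c y = 0 := apply_projPerp_self hcc.ne' _
    refine ⟨h1, ?_⟩
    rw [hc, BilinForm.projPerp] at h2
    simpa [h1] using h2
  exact ⟨_, ⟨(key e).1, (key e).2, by simpa using h' 1 0 (by simp)⟩,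
    _, ⟨(key f).1, (key f).2, by simpa using h' 0 1 (by simp)⟩, h'⟩

lemma segment_subset_negPerp (hx : x ∈ negPerp B a a') (hy : y ∈ negPerp B a a')
    (h : ∀ s t : ℝ, 0 ≤ s → 0 ≤ t → s + t = 1 → B (s • x + t • y) (s • x + t • y) < 0) :
    segment ℝ x y ⊆ negPerp B a a' := by
  rintro _ ⟨s, t, hs, ht, hst, rfl⟩
  exact ⟨by simp [hx.1, hy.1], by simp [hx.2.1, hy.2.1], h s t hs ht hst⟩

variable [TopologicalSpace V] [IsTopologicalAddGroup V] [ContinuousSMul ℝ V]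

lemma joinedIn_negPerp_of_nonpos (hB : B.IsSymm) (hx : x ∈ negPerp B a a')
    (hy : y ∈ negPerp B a a') (hxy : B x y ≤ 0) : JoinedIn (negPerp B a a') x y := by
  refine .of_segment_subset (segment_subset_negPerp hx hy fun s t hs ht hst ↦ ?_)
  have hxx := hx.2.2
  have hyy := hy.2.2
  have heq : B (s • x + t • y) (s • x + t • y)
      = s ^ 2 * B x x + 2 * (s * t) * B x y + t ^ 2 * B y y := by
    simp only [map_add, map_smul, LinearMap.add_apply, LinearMap.smul_apply, smul_eq_mul, hB.eq y x]
    ring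
  rw [heq]
  have h1 : s * t * B x y ≤ 0 := mul_nonpos_of_nonneg_of_nonpos (by positivity) hxy
  have h2 : s ^ 2 * B x x ≤ 0 := mul_nonpos_of_nonneg_of_nonpos (by positivity) hxx.le
  rcases ht.eq_or_lt with rfl | ht
  · obtain rfl : s = 1 := by linarith
    simpa using hxx
  · have : t ^ 2 * B y y < 0 := mul_neg_of_pos_of_neg (by positivity) hyy
    linarith

lemma SpansNegPlane.joinedIn_negPerp (h : SpansNegPlane B x y) (hx : x ∈ negPerp B a a')
    (hy : y ∈ negPerp B a a') : JoinedIn (negPerp B a a') x y := by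
  refine .of_segment_subset (segment_subset_negPerp hx hy fun s t _ _ hst ↦ h s t ?_)
  by_contra! h0
  simp [h0.1, h0.2] at hst

lemma SpansNegPlane.isPathConnected_negPerp (hB : B.IsSymm) (ha : 0 < B a a)
    (hdet : B a a' ^ 2 < B a a * B a' a') (h : SpansNegPlane B e f) :
    IsPathConnected (negPerp B a a') := by
  obtain ⟨e', he, f', hf, h'⟩ := h.exists_mem_negPerp hB ha hdet
  have hneg : SpansNegPlane B f' (-e') := fun s t hst ↦ by
    have := h' (-t) s (by simpa using hst.symm)
    rwa [show s • f' + t • (-e') = (-t) • e' + s • f' by module]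
  have hee : JoinedIn (negPerp B a a') e' (-e') :=
    (h'.joinedIn_negPerp he hf).trans (hneg.joinedIn_negPerp hf (neg_mem_negPerp he))
  refine ⟨e', he, fun {y} hy ↦ ?_⟩
  rcases le_total (B e' y) 0 with hle | hle
  · exact joinedIn_negPerp_of_nonpos hB he hy hle
  · exact hee.trans (joinedIn_negPerp_of_nonpos hB (neg_mem_negPerp he) hy (by simpa using hle))

lemma card_connectedComponents_negPerp (hB : B.IsSymm) (hcont : ∀ v, Continuous (B v))
    (hindex : ∀ x y z, B x x < 0 → B y y < 0 → B z z < 0 →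
      B x y = 0 → B x z = 0 → B y z = 0 → False)
    (ha : 0 < B a a) (hdet : B a a * B a' a' < B a a' ^ 2) (hne : (negPerp B a a').Nonempty) :
    Nat.card (ConnectedComponents (negPerp B a a')) = 2 := by
  obtain ⟨u, hu⟩ := hne
  have hu' := neg_mem_negPerp hu
  have hcc : B (projPerp B a a') (projPerp B a a') < 0 := by
    rw [projPerp_apply_self hB ha.ne', sub_neg, lt_div_iff₀ ha]
    linarith
  have hperp {x : V} (hx : x ∈ negPerp B a a') : B (projPerp B a a') x = 0 := by
    simp [projPerp, hx.1, hx.2.1]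
  have hux {x : V} (hx : x ∈ negPerp B a a') : B u x ≠ 0 := fun h ↦
    hindex _ _ _ hcc hu.2.2 hx.2.2 (hperp hu) (hperp hx) h
  let S : Set (negPerp B a a') := {x | B u x < 0}
  have hg : Continuous fun x : negPerp B a a' ↦ B u x := (hcont u).comp continuous_subtype_val
  have hS : IsClopen S := by
    refine ⟨?_, isOpen_lt hg continuous_const⟩
    convert isClosed_le hg (continuous_const (y := (0 : ℝ))) using 1
    ext x
    exact ⟨fun h : B u x < 0 ↦ h.le, fun h : B u x ≤ 0 ↦ lt_of_le_of_ne h (hux x.2)⟩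
  have hF := (continuous_boolIndicator_iff_isClopen S).2 hS
  have hbij : Function.Bijective hF.connectedComponentsLift := by
    have hjoin {x y : negPerp B a a'} (h : JoinedIn (negPerp B a a') (x : V) y) :
        (x : ConnectedComponents (negPerp B a a')) = y :=
      (ConnectedComponents.coe_eq_coe'.2 (pathComponent_subset_component _ h.joined_subtype)).symm
    constructor
    · intro p q hpq
      obtain ⟨x, rfl⟩ := ConnectedComponents.surjective_coe p
      obtain ⟨y, rfl⟩ := ConnectedComponents.surjective_coe q
      rw [hF.connectedComponentsLift_apply_coe, hF.connectedComponentsLift_apply_coe] at hpq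
      by_cases hx : x ∈ S
      · have hy : y ∈ S := by
          rw [Set.mem_iff_boolIndicator] at hx ⊢
          rw [← hpq, hx]
        exact hjoin ((joinedIn_negPerp_of_nonpos hB hu x.2 (le_of_lt hx)).symm.trans
          (joinedIn_negPerp_of_nonpos hB hu y.2 (le_of_lt hy)))
      · have hy : y ∉ S := by
          rw [Set.notMem_iff_boolIndicator] at hx ⊢
          rw [← hpq, hx]
        have hx' : B (-u) x ≤ 0 := by simpa [S] using hx
        have hy' : B (-u) y ≤ 0 := by simpa [S] using hy
        exact hjoin ((joinedIn_negPerp_of_nonpos hB hu' x.2 hx').symm.trans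
          (joinedIn_negPerp_of_nonpos hB hu' y.2 hy'))
    · rintro (_ | _)
      · refine ⟨((⟨-u, hu'⟩ : negPerp B a a') : ConnectedComponents _), ?_⟩
        rw [hF.connectedComponentsLift_apply_coe, ← Set.notMem_iff_boolIndicator]
        simpa [S] using hu.2.2.le
      · refine ⟨((⟨u, hu⟩ : negPerp B a a') : ConnectedComponents _), ?_⟩
        rw [hF.connectedComponentsLift_apply_coe, ← Set.mem_iff_boolIndicator]
        exact hu.2.2
  rw [Nat.card_congr (Equiv.ofBijective _ hbij)]
  simp

end LinearMap.BilinForm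

open LinearMap.BilinForm

lemma bm1_self {n : ℕ} (x : Fin (n + 1) → ℝ) : bm1 x x = qm1 x := by
  simp only [bm1, qm1, sq]

/-- `bm1` as a bundled bilinear form. -/
noncomputable def bm1Form (n : ℕ) : LinearMap.BilinForm ℝ (Fin (n + 1) → ℝ) :=
  LinearMap.mk₂ ℝ bm1
    (fun x y z ↦ by simp only [bm1, Pi.add_apply, add_mul, Finset.sum_add_distrib]; ring)
    (fun c x y ↦ by
      simp only [bm1, Pi.smul_apply, smul_eq_mul, mul_assoc, ← Finset.mul_sum]; ring)
    (fun x y z ↦ by simp only [bm1, Pi.add_apply, mul_add, Finset.sum_add_distrib]; ring)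
    (fun c x y ↦ by
      simp only [bm1, Pi.smul_apply, smul_eq_mul, mul_left_comm _ c, ← Finset.mul_sum]; ring)

@[simp]
lemma bm1Form_apply {n : ℕ} (x y : Fin (n + 1) → ℝ) : bm1Form n x y = bm1 x y := rfl

lemma bm1Form_isSymm (n : ℕ) : (bm1Form n).IsSymm :=
  ⟨fun x y ↦ by simp only [bm1Form_apply, bm1, mul_comm]⟩

/-- Three pairwise orthogonal vectors cannot all be negative: `qm1` has index two. -/
lemma bm1Form_index {n : ℕ} (x y z : Fin (n + 1) → ℝ)
    (hx : bm1Form n x x < 0) (hy : bm1Form n y y < 0) (hz : bm1Form n z z < 0)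
    (hxy : bm1Form n x y = 0) (hxz : bm1Form n x z = 0) (hyz : bm1Form n y z = 0) : False := by
  have hker : LinearMap.ker
      (Matrix.mulVecLin !![x 0, y 0, z 0; x (Fin.last n), y (Fin.last n), z (Fin.last n)]) ≠ ⊥ :=
    LinearMap.ker_ne_bot_of_finrank_lt (by simp)
  obtain ⟨c, hc, hc0⟩ := Submodule.exists_mem_ne_zero_of_ne_bot hker
  have hc1 := congrFun (LinearMap.mem_ker.1 hc) 0
  have hc2 := congrFun (LinearMap.mem_ker.1 hc) 1
  simp [Matrix.mulVec, dotProduct, Fin.sum_univ_three] at hc1 hc2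
  set v := c 0 • x + c 1 • y + c 2 • z with hv
  have hv0 : v 0 = 0 := by simp [hv]; linarith
  have hvn : v (Fin.last n) = 0 := by simp [hv]; linarith
  have hpos : 0 ≤ bm1Form n v v := by
    rw [bm1Form_apply, bm1_self, qm1, hv0, hvn]
    simpa using Finset.sum_nonneg fun i _ ↦ sq_nonneg (v i)
  have hsymm := (bm1Form_isSymm n).eq
  have heq : bm1Form n v v = c 0 ^ 2 * bm1Form n x x + c 1 ^ 2 * bm1Form n y y
      + c 2 ^ 2 * bm1Form n z z := by
    simp only [hv, map_add, map_smul, LinearMap.add_apply, LinearMap.smul_apply, smul_eq_mul, hxy,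
      hxz, hyz, hsymm y x, hsymm z x, hsymm z y]
    ring
  have h0 : c 0 ^ 2 * bm1Form n x x ≤ 0 := mul_nonpos_of_nonneg_of_nonpos (sq_nonneg _) hx.le
  have h1 : c 1 ^ 2 * bm1Form n y y ≤ 0 := mul_nonpos_of_nonneg_of_nonpos (sq_nonneg _) hy.le
  have h2 : c 2 ^ 2 * bm1Form n z z ≤ 0 := mul_nonpos_of_nonneg_of_nonpos (sq_nonneg _) hz.le
  have h0' : c 0 ^ 2 * bm1Form n x x = 0 := by linarith
  have h1' : c 1 ^ 2 * bm1Form n y y = 0 := by linarith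
  have h2' : c 2 ^ 2 * bm1Form n z z = 0 := by linarith
  simp only [mul_eq_zero, hx.ne, hy.ne, hz.ne, or_false, pow_eq_zero_iff two_ne_zero] at h0' h1' h2'
  exact hc0 (funext fun i ↦ by fin_cases i <;> simp [h0', h1', h2'])

lemma bm1Form_spansNegPlane {n : ℕ} (hn : n ≠ 0) :
    SpansNegPlane (bm1Form n) (Pi.single 0 1) (Pi.single (Fin.last n) 1) := by
  intro s t hst
  have hne : Fin.last n ≠ 0 := by simpa [Fin.ext_iff] using hn
  have h1 : bm1Form n (Pi.single 0 1) (Pi.single 0 1) = -1 := by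
    simp [bm1, Pi.single_apply, hne]; norm_num
  have h2 : bm1Form n (Pi.single (Fin.last n) 1) (Pi.single (Fin.last n) 1) = -1 := by
    simp [bm1, Pi.single_apply, hne.symm]; norm_num
  have h3 : bm1Form n (Pi.single 0 1) (Pi.single (Fin.last n) 1) = 0 := by
    simp [bm1, Pi.single_apply, hne, hne.symm]
  simp only [map_add, map_smul, LinearMap.add_apply, LinearMap.smul_apply, smul_eq_mul, h1, h2, h3,
    (bm1Form_isSymm n).eq (Pi.single (Fin.last n) 1) (Pi.single 0 1)]
  rcases hst with h | h
  · nlinarith [sq_pos_of_ne_zero h, sq_nonneg t]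
  · nlinarith [sq_pos_of_ne_zero h, sq_nonneg s]

/-- The vector that represents the covector `α` with respect to `bm1`. -/
def bm1Dual {n : ℕ} (α : Fin (n + 1) → ℝ) (i : Fin (n + 1)) : ℝ :=
  if i = 0 ∨ i = Fin.last n then -α i else α i

lemma bm1Dual_apply_zero {n : ℕ} (α : Fin (n + 1) → ℝ) : bm1Dual α 0 = -α 0 := by
  simp [bm1Dual]

lemma bm1Dual_apply_last {n : ℕ} (α : Fin (n + 1) → ℝ) :
    bm1Dual α (Fin.last n) = -α (Fin.last n) := by
  simp [bm1Dual]

lemma bm1_bm1Dual_left {n : ℕ} (hn : n ≠ 0) (α x : Fin (n + 1) → ℝ) :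
    bm1 (bm1Dual α) x = ∑ i, α i * x i := by
  have hne : Fin.last n ≠ 0 := by simpa [Fin.ext_iff] using hn
  have hterm (i : Fin (n + 1)) : bm1Dual α i * x i = α i * x i
      - (if i = 0 then 2 * (α i * x i) else 0)
      - (if i = Fin.last n then 2 * (α i * x i) else 0) := by
    by_cases h0 : i = 0
    · subst h0
      simp [bm1Dual, hne.symm]; ring
    · by_cases h1 : i = Fin.last n
      · subst h1
        simp [bm1Dual, hne]; ring
      · simp [bm1Dual, h0, h1]
  rw [bm1, bm1Dual_apply_zero, bm1Dual_apply_last, Finset.sum_congr rfl fun i _ ↦ hterm i]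
  simp only [Finset.sum_sub_distrib, Finset.sum_ite_eq', Finset.mem_univ, if_true]
  ring

lemma bm1_bm1Dual_bm1Dual {n : ℕ} (α α' : Fin (n + 1) → ℝ) :
    bm1 (bm1Dual α) (bm1Dual α') = bm1 α α' := by
  have hterm (i : Fin (n + 1)) : bm1Dual α i * bm1Dual α' i = α i * α' i := by
    unfold bm1Dual
    split_ifs <;> ring
  simp only [bm1, hterm]

lemma qm1_bm1Dual {n : ℕ} (α : Fin (n + 1) → ℝ) : qm1 (bm1Dual α) = qm1 α := by
  rw [← bm1_self, bm1_bm1Dual_bm1Dual, bm1_self]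

/-- Two timelike hyperplanes of Anti-de Sitter space (defining covectors with positive
`q₋₁`) always intersect in `AdSⁿ`; the intersection has two connected components if
`b₋₁(α,α')² > q₋₁(α)q₋₁(α')` (spacelike intersection) and is connected if
`b₋₁(α,α')² < q₋₁(α)q₋₁(α')` (timelike intersection). -/
theorem adS_timelike_hyperplanes_intersection (n : ℕ) (hn : 3 ≤ n)
    (α α' : Fin (n + 1) → ℝ) (hli : LinearIndependent ℝ ![α, α'])
    (hα : 0 < qm1 α) (hα' : 0 < qm1 α') :
    (Set.Nonempty {x : Fin (n + 1) → ℝ |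
        (∑ i, α i * x i) = 0 ∧ (∑ i, α' i * x i) = 0 ∧ qm1 x < 0}) ∧
    (qm1 α * qm1 α' < (bm1 α α') ^ 2 →
      Nat.card (ConnectedComponents
        {x : Fin (n + 1) → ℝ //
          (∑ i, α i * x i) = 0 ∧ (∑ i, α' i * x i) = 0 ∧ qm1 x < 0}) = 2) ∧
    ((bm1 α α') ^ 2 < qm1 α * qm1 α' →
      IsConnected {x : Fin (n + 1) → ℝ |
        (∑ i, α i * x i) = 0 ∧ (∑ i, α' i * x i) = 0 ∧ qm1 x < 0}) := by
  have hn0 : n ≠ 0 := by omega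
  have hplane := bm1Form_spansNegPlane hn0
  have hB := bm1Form_isSymm n
  have hK : {x : Fin (n + 1) → ℝ |
      (∑ i, α i * x i) = 0 ∧ (∑ i, α' i * x i) = 0 ∧ qm1 x < 0}
      = negPerp (bm1Form n) (bm1Dual α) (bm1Dual α') := by
    simp only [negPerp, bm1Form_apply, bm1_bm1Dual_left hn0, bm1_self]
  have ha : 0 < bm1Form n (bm1Dual α) (bm1Dual α) := by
    rwa [bm1Form_apply, bm1_self, qm1_bm1Dual]
  have hne : (negPerp (bm1Form n) (bm1Dual α) (bm1Dual α')).Nonempty :=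
    hplane.negPerp_nonempty hB ha
  refine ⟨hK ▸ hne, fun hdet ↦ ?_, fun hdet ↦ ?_⟩
  · change Nat.card (ConnectedComponents {x : Fin (n + 1) → ℝ |
      (∑ i, α i * x i) = 0 ∧ (∑ i, α' i * x i) = 0 ∧ qm1 x < 0}) = 2
    rw [hK]
    refine card_connectedComponents_negPerp hB
      (fun v ↦ (bm1Form n v).continuous_of_finiteDimensional) bm1Form_index ha ?_ hne
    simpa only [bm1Form_apply, bm1_bm1Dual_bm1Dual, bm1_self, qm1_bm1Dual] using hdet
  · rw [hK]
    refine (hplane.isPathConnected_negPerp hB ha ?_).isConnected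
    simpa only [bm1Form_apply, bm1_bm1Dual_bm1Dual, bm1_self, qm1_bm1Dual] using hdet
end

section
/- Let n ≥ 2 and let α = (α₀,…,αₙ) ∈ ℝ^{n+1} be nonzero. There exists x = (x₀,…,xₙ) ∈ ℝ^{n+1} with q₀(x) < 0, x₀ > 0 and α₀x₀ + ⋯ + αₙxₙ = 0 if and only if αₙ ≠ 0 or −α₀² + α₁² + ⋯ + α_{n−1}² > 0. -/
/-- The degenerate quadratic form `q₀(x) = -x₀² + x₁² + ⋯ + x_{n-1}²` on `ℝ^{n+1}`. -/
noncomputable def q0 {n : ℕ} (x : Fin (n + 1) → ℝ) : ℝ :=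
  ∑ i, x i ^ 2 - 2 * x 0 ^ 2 - x (Fin.last n) ^ 2

theorem Fin.sum_univ_first_middle_last {M : Type*} [AddCommMonoid M] {m : ℕ}
    (f : Fin (m + 2) → M) :
    ∑ i, f i = f 0 + ∑ i : Fin m, f i.castSucc.succ + f (Fin.last (m + 1)) := by
  rw [Fin.sum_univ_succ, Fin.sum_univ_castSucc, ← add_assoc, Fin.succ_last]

theorem q0_eq_middle {m : ℕ} (x : Fin (m + 2) → ℝ) :
    q0 x = ∑ i : Fin m, x i.castSucc.succ ^ 2 - x 0 ^ 2 := by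
  rw [q0, Fin.sum_univ_first_middle_last]
  ring

theorem eq_zero_of_first_middle_last {M : Type*} [Zero M] {m : ℕ} {f : Fin (m + 2) → M}
    (h0 : f 0 = 0) (hmid : ∀ i : Fin m, f i.castSucc.succ = 0)
    (hlast : f (Fin.last (m + 1)) = 0) : f = 0 := by
  funext i
  refine Fin.cases h0 (fun j => ?_) i
  refine Fin.lastCases ?_ hmid j
  rwa [Fin.succ_last]

/-- The vector with prescribed first, middle and last coordinates. -/
def ofFirstMiddleLast {m : ℕ} (a : ℝ) (v : Fin m → ℝ) (b : ℝ) : Fin (m + 2) → ℝ :=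
  Fin.cons a (Fin.snoc v b)

section ofFirstMiddleLast

variable {m : ℕ} (a : ℝ) (v : Fin m → ℝ) (b : ℝ)

@[simp]
theorem ofFirstMiddleLast_zero : ofFirstMiddleLast a v b 0 = a := rfl

@[simp]
theorem ofFirstMiddleLast_middle (i : Fin m) :
    ofFirstMiddleLast a v b i.castSucc.succ = v i := by
  simp only [ofFirstMiddleLast, Fin.cons_succ, Fin.snoc_castSucc]

@[simp]
theorem ofFirstMiddleLast_last : ofFirstMiddleLast a v b (Fin.last (m + 1)) = b := by
  rw [← Fin.succ_last]
  simp only [ofFirstMiddleLast, Fin.cons_succ, Fin.snoc_last]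

end ofFirstMiddleLast

/-- The reverse Cauchy–Schwarz argument: a covector orthogonal to a timelike vector, with
vanishing last coordinate, is spacelike. -/
theorem q0_pos_of_orthogonal {m : ℕ} {α x : Fin (m + 2) → ℝ} (hα : α ≠ 0)
    (hlast : α (Fin.last (m + 1)) = 0) (hq : q0 x < 0) (hsum : ∑ i, α i * x i = 0) :
    0 < q0 α := by
  rw [q0_eq_middle] at hq ⊢
  rw [Fin.sum_univ_first_middle_last, hlast, zero_mul, add_zero] at hsum
  have hcs := Finset.sum_mul_sq_le_sq_mul_sq Finset.univ
    (fun i : Fin m => α i.castSucc.succ) (fun i => x i.castSucc.succ)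
  rw [← neg_eq_of_add_eq_zero_right hsum] at hcs
  have hx : 0 ≤ ∑ i : Fin m, x i.castSucc.succ ^ 2 := Finset.sum_nonneg fun _ _ => sq_nonneg _
  by_contra! hle
  have hle' : ∑ i : Fin m, α i.castSucc.succ ^ 2 ≤ α 0 ^ 2 := by linarith
  have h0 : α 0 = 0 := by
    by_contra h
    have hpos : 0 < α 0 ^ 2 := by positivity
    nlinarith [mul_le_mul_of_nonneg_right hle' hx, mul_pos hpos (neg_pos.2 hq)]
  have hmid : ∑ i : Fin m, α i.castSucc.succ ^ 2 = 0 :=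
    le_antisymm (by simpa [h0] using hle') (Finset.sum_nonneg fun _ _ => sq_nonneg _)
  rw [Finset.sum_eq_zero_iff_of_nonneg fun _ _ => sq_nonneg _] at hmid
  exact hα (eq_zero_of_first_middle_last h0
    (fun i => pow_eq_zero_iff two_ne_zero |>.1 (hmid i (Finset.mem_univ i))) hlast)

theorem exists_orthogonal_of_last_ne_zero {m : ℕ} {α : Fin (m + 2) → ℝ}
    (hlast : α (Fin.last (m + 1)) ≠ 0) :
    ∃ x : Fin (m + 2) → ℝ, q0 x < 0 ∧ 0 < x 0 ∧ ∑ i, α i * x i = 0 := by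
  refine ⟨ofFirstMiddleLast 1 0 (-α 0 / α (Fin.last (m + 1))), ?_, ?_, ?_⟩
  · simp [q0_eq_middle]
  · simp
  · simp [Fin.sum_univ_first_middle_last, mul_div_cancel₀ _ hlast]

theorem exists_orthogonal_of_q0_pos {m : ℕ} {α : Fin (m + 2) → ℝ} (hq : 0 < q0 α) :
    ∃ x : Fin (m + 2) → ℝ, q0 x < 0 ∧ 0 < x 0 ∧ ∑ i, α i * x i = 0 := by
  rw [q0_eq_middle] at hq
  set S := ∑ i : Fin m, α i.castSucc.succ ^ 2 with hS
  have hSpos : 0 < S := by nlinarith [sq_nonneg (α 0)]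
  refine ⟨ofFirstMiddleLast S (fun i => -α 0 * α i.castSucc.succ) 0, ?_, by simpa, ?_⟩
  · simp only [q0_eq_middle, ofFirstMiddleLast_zero, ofFirstMiddleLast_middle, mul_pow,
      ← Finset.mul_sum, ← hS]
    nlinarith [mul_pos hSpos hq]
  · have hmid : ∑ i : Fin m, α i.castSucc.succ * (-α 0 * α i.castSucc.succ) = -α 0 * S := by
      rw [hS, Finset.mul_sum]
      exact Finset.sum_congr rfl fun _ _ => by ring
    simp only [Fin.sum_univ_first_middle_last, ofFirstMiddleLast_zero,
      ofFirstMiddleLast_middle, ofFirstMiddleLast_last, hmid]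
    ring

/-- A hyperplane of the projective sphere, determined by a nonzero covector `α`, meets
half-pipe space `HPⁿ = {[x] : q₀(x) < 0, x₀ ≥ 0}` if and only if `αₙ ≠ 0` or `q₀(α) > 0`. -/
theorem hyperplane_meets_halfpipe_iff (n : ℕ) (hn : 2 ≤ n)
    (α : Fin (n + 1) → ℝ) (hα : α ≠ 0) :
    (∃ x : Fin (n + 1) → ℝ, q0 x < 0 ∧ 0 < x 0 ∧ (∑ i, α i * x i) = 0) ↔
      (α (Fin.last n) ≠ 0 ∨ 0 < q0 α) := by
  obtain ⟨m, rfl⟩ : ∃ m, n = m + 1 := ⟨n - 1, by omega⟩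
  constructor
  · rintro ⟨x, hq, -, hsum⟩
    exact or_iff_not_imp_left.2 fun h => q0_pos_of_orthogonal hα (not_not.1 h) hq hsum
  · rintro (h | h)
    · exact exists_orthogonal_of_last_ne_zero h
    · exact exists_orthogonal_of_q0_pos h
end

section
/- Let n ≥ 2 and let â = (â₀,…,â_{n−1}), â′ = (â′₀,…,â′_{n−1}) ∈ ℝⁿ satisfy q̂(â) < 0, q̂(â′) < 0 and â ≠ â′, where q̂(y) = −y₀² + y₁² + ⋯ + y_{n−1}². Then there exists x = (x₀,…,xₙ) ∈ ℝ^{n+1} with q₀(x) < 0, x₀ > 0, â₀x₀ + ⋯ + â_{n−1}x_{n−1} + xₙ = 0 and â′₀x₀ + ⋯ + â′_{n−1}x_{n−1} + xₙ = 0, if and only if q̂(â − â′) > 0. -/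
/-- The Minkowski quadratic form `q̂(y) = -y₀² + y₁² + ⋯ + y_{n-1}²` on `ℝⁿ`. -/
noncomputable def qhat {n : ℕ} (hn : 0 < n) (y : Fin n → ℝ) : ℝ :=
  ∑ i, y i ^ 2 - 2 * y ⟨0, hn⟩ ^ 2

theorem qhat_succ {m : ℕ} (h : 0 < m + 1) (y : Fin (m + 1) → ℝ) :
    qhat h y = ∑ i : Fin m, y i.succ ^ 2 - y 0 ^ 2 := by
  simp only [qhat, Fin.sum_univ_succ, Fin.mk_zero]
  ring

theorem q0_eq_qhat {m : ℕ} (h : 0 < m + 1) (x : Fin (m + 2) → ℝ) :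
    q0 x = qhat h (fun i => x i.castSucc) := by
  simp only [q0, qhat, Fin.sum_univ_castSucc (n := m + 1), Fin.mk_zero, Fin.castSucc_zero]
  ring

/-- A nonzero vector of Minkowski space is spacelike if and only if it pairs to zero
with some future-directed timelike vector. -/
theorem exists_timelike_orthogonal_iff {m : ℕ} (h : 0 < m + 1) {d : Fin (m + 1) → ℝ}
    (hd : d ≠ 0) :
    (∃ y : Fin (m + 1) → ℝ, qhat h y < 0 ∧ 0 < y 0 ∧ ∑ i, d i * y i = 0) ↔ 0 < qhat h d := by
  simp only [qhat_succ, Fin.sum_univ_succ, sub_neg, sub_pos]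
  constructor
  · rintro ⟨y, hy, hy0, horth⟩
    have hcs := Finset.sum_mul_sq_le_sq_mul_sq Finset.univ
      (fun i : Fin m => d i.succ) (fun i => y i.succ)
    have hsum : ∑ i : Fin m, d i.succ * y i.succ = -(d 0 * y 0) := by linarith
    rw [hsum] at hcs
    have hnonneg : 0 ≤ ∑ i : Fin m, d i.succ ^ 2 := Finset.sum_nonneg fun i _ => sq_nonneg _
    have hpos : 0 < ∑ i : Fin m, d i.succ ^ 2 := by
      refine lt_of_le_of_ne hnonneg fun hzero => hd ?_
      rw [← hzero] at hcs
      have hd0 : d 0 = 0 := by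
        have : d 0 * y 0 = 0 := by nlinarith
        exact (mul_eq_zero.mp this).resolve_right hy0.ne'
      have hds := (Finset.sum_eq_zero_iff_of_nonneg fun i _ => sq_nonneg _).mp hzero.symm
      funext i
      refine Fin.cases hd0 (fun j => ?_) i
      simpa using hds j (Finset.mem_univ j)
    have hlt := mul_lt_mul_of_pos_left hy hpos
    have hy2 : 0 < y 0 ^ 2 := by positivity
    refine lt_of_mul_lt_mul_right ?_ hy2.le
    linarith [mul_pow (d 0) (y 0) 2, neg_sq (d 0 * y 0)]
  · intro hlt
    have hpos : 0 < ∑ i : Fin m, d i.succ ^ 2 := (sq_nonneg _).trans_lt hlt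
    refine ⟨Fin.cons (∑ i : Fin m, d i.succ ^ 2) fun i => -d 0 * d i.succ, ?_, ?_, ?_⟩
    · simp only [Fin.cons_zero, Fin.cons_succ, mul_pow, ← Finset.mul_sum, neg_sq]
      nlinarith
    · simpa using hpos
    · have hsum : ∑ i : Fin m, d i.succ * (-d 0 * d i.succ)
          = -d 0 * ∑ i : Fin m, d i.succ ^ 2 := by
        rw [Finset.mul_sum]
        exact Finset.sum_congr rfl fun i _ => by ring
      simp only [Fin.cons_zero, Fin.cons_succ, hsum]
      ring

/-- Two spacelike hyperplanes of half-pipe space, with defining covectors `(â : 1)` and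
`(â' : 1)` where `q̂(â), q̂(â') < 0` and `â ≠ â'`, intersect transversely in `HPⁿ` if and
only if the segment `â - â'` is spacelike in Minkowski space, i.e. `q̂(â - â') > 0`. -/
theorem halfpipe_spacelike_hyperplanes_transverse_iff (n : ℕ) (hn : 2 ≤ n)
    (a a' : Fin n → ℝ)
    (ha : qhat (by omega) a < 0) (ha' : qhat (by omega) a' < 0) (hne : a ≠ a') :
    (∃ x : Fin (n + 1) → ℝ, q0 x < 0 ∧ 0 < x 0 ∧
        (∑ i : Fin n, a i * x i.castSucc) + x (Fin.last n) = 0 ∧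
        (∑ i : Fin n, a' i * x i.castSucc) + x (Fin.last n) = 0) ↔
      0 < qhat (by omega) (a - a') := by
  obtain ⟨m, rfl⟩ : ∃ m, n = m + 1 := ⟨n - 1, by omega⟩
  rw [← exists_timelike_orthogonal_iff _ (sub_ne_zero.mpr hne)]
  simp only [Pi.sub_apply, sub_mul, Finset.sum_sub_distrib]
  constructor
  · rintro ⟨x, hq, h0, h1, h2⟩
    exact ⟨fun i => x i.castSucc, q0_eq_qhat (by omega) x ▸ hq, h0, by linarith⟩
  · rintro ⟨y, hq, h0, h1⟩
    refine ⟨Fin.snoc (α := fun _ => ℝ) y (-∑ i, a i * y i), ?_, ?_, ?_, ?_⟩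
    · rw [q0_eq_qhat (by omega)]
      simpa only [Fin.snoc_castSucc] using hq
    · rw [← Fin.castSucc_zero, Fin.snoc_castSucc]
      exact h0
    · simp only [Fin.snoc_castSucc, Fin.snoc_last]
      ring
    · simp only [Fin.snoc_castSucc, Fin.snoc_last]
      linarith
end

section
/- Let n ≥ 2. For s ∈ ℝ define the linear map A_s : ℝ^{n+1} → ℝ^{n+1} by A_s(x₀, x₁, x₂, …, x_{n−1}, xₙ) = (x₀, −x₁, x₂, …, x_{n−1}, xₙ − 2s·x₁). Then for every s ∈ ℝ: A_s ∘ A_s = id; q₀(A_s x) = q₀(x) for all x; A_s(eₙ) = eₙ; the 0-th coordinate of A_s(e₀) equals 1 > 0; A_s fixes pointwise the hyperplane {x : x₁ = 0}; and A_s ≠ id. Moreover A_s ≠ A_{s′} whenever s ≠ s′. Hence the degenerate half-pipe hyperplane {x₁ = 0} is fixed pointwise by a one-parameter family of pairwise distinct reflections in the half-pipe group G_{HPⁿ}. -/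
/-- The map `A_s(x₀, x₁, x₂, …, x_{n-1}, xₙ) = (x₀, -x₁, x₂, …, x_{n-1}, xₙ - 2s·x₁)`. -/
noncomputable def Arefl (n : ℕ) (s : ℝ) (x : Fin (n + 1) → ℝ) : Fin (n + 1) → ℝ :=
  fun i => if i = 1 then -x 1
    else if i = Fin.last n then x (Fin.last n) - 2 * s * x 1
    else x i

@[simp]
theorem Arefl_apply_one (n : ℕ) (s : ℝ) (x : Fin (n + 1) → ℝ) : Arefl n s x 1 = -x 1 := by
  simp [Arefl]

theorem Arefl_apply_last {n : ℕ} (h : Fin.last n ≠ 1) (s : ℝ) (x : Fin (n + 1) → ℝ) :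
    Arefl n s x (Fin.last n) = x (Fin.last n) - 2 * s * x 1 := by
  simp [Arefl, h]

theorem Arefl_apply_of_ne {n : ℕ} {i : Fin (n + 1)} (h₁ : i ≠ 1) (hl : i ≠ Fin.last n)
    (s : ℝ) (x : Fin (n + 1) → ℝ) : Arefl n s x i = x i := by
  simp [Arefl, h₁, hl]

theorem isLinearMap_Arefl (n : ℕ) (s : ℝ) : IsLinearMap ℝ (Arefl n s) where
  map_add x y := by
    ext i
    simp only [Arefl, Pi.add_apply]
    split_ifs <;> ring
  map_smul c x := by
    ext i
    simp only [Arefl, Pi.smul_apply, smul_eq_mul]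
    split_ifs <;> ring

theorem Arefl_Arefl {n : ℕ} (h : Fin.last n ≠ 1) (s : ℝ) (x : Fin (n + 1) → ℝ) :
    Arefl n s (Arefl n s x) = x := by
  ext i
  by_cases h₁ : i = 1
  · simp [h₁]
  by_cases hl : i = Fin.last n
  · subst hl
    simp [Arefl_apply_last h]
  · simp [Arefl_apply_of_ne h₁ hl]

theorem Arefl_eq_self {n : ℕ} (s : ℝ) {x : Fin (n + 1) → ℝ} (hx : x 1 = 0) :
    Arefl n s x = x := by
  ext i
  simp only [Arefl, hx]
  split_ifs with h₁ hl <;> simp [*]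

theorem q0_Arefl {n : ℕ} (h₀ : (0 : Fin (n + 1)) ≠ 1) (h₀l : 0 ≠ Fin.last n) (s : ℝ)
    (x : Fin (n + 1) → ℝ) : q0 (Arefl n s x) = q0 x := by
  have hsum : ∑ i : Fin n, Arefl n s x i.castSucc ^ 2 = ∑ i : Fin n, x i.castSucc ^ 2 := by
    refine Finset.sum_congr rfl fun i _ => ?_
    by_cases h₁ : i.castSucc = 1
    · simp [h₁]
    · rw [Arefl_apply_of_ne h₁ (Fin.castSucc_lt_last i).ne]
  simp only [q0, Fin.sum_univ_castSucc, hsum, Arefl_apply_of_ne h₀ h₀l]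
  ring

/-- The degenerate hyperplane `{x₁ = 0}` of half-pipe space is fixed pointwise by the
one-parameter family of pairwise distinct reflections `A_s` in the half-pipe group. -/
theorem halfpipe_degenerate_hyperplane_reflections (n : ℕ) (hn : 2 ≤ n) (s : ℝ) :
    IsLinearMap ℝ (Arefl n s) ∧
    (∀ x, Arefl n s (Arefl n s x) = x) ∧
    (∀ x, q0 (Arefl n s x) = q0 x) ∧
    Arefl n s (Pi.single (Fin.last n) 1) = Pi.single (Fin.last n) 1 ∧
    (Arefl n s (Pi.single 0 1)) 0 = 1 ∧
    (∀ x, x 1 = 0 → Arefl n s x = x) ∧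
    Arefl n s ≠ id ∧
    (∀ s' : ℝ, s ≠ s' → Arefl n s ≠ Arefl n s') := by
  have h₀ : (0 : Fin (n + 1)) ≠ 1 := by
    simp only [ne_eq, Fin.zero_eq_one_iff]; omega
  have h₀l : 0 ≠ Fin.last n := by
    simp only [ne_eq, Fin.ext_iff, Fin.val_zero, Fin.val_last]; omega
  have hl : Fin.last n ≠ 1 := by
    rw [ne_eq, Fin.ext_iff, Fin.val_last, Fin.val_one', Nat.mod_eq_of_lt (by omega)]; omega
  refine ⟨isLinearMap_Arefl n s, Arefl_Arefl hl s, q0_Arefl h₀ h₀l s,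
    Arefl_eq_self s (by simp [hl.symm]), by simp [Arefl_apply_of_ne h₀ h₀l],
    fun x hx => Arefl_eq_self s hx, fun h => ?_, fun s' hs h => hs ?_⟩
  · have := congrFun (congrFun h (Pi.single 1 1)) 1
    norm_num at this
  · simpa [Arefl_apply_last hl] using congrFun (congrFun h (Pi.single 1 1)) (Fin.last n)
end

section
/- Let n ≥ 2 and let θ : ℝ → ℝ be differentiable at 0 with θ(0) = 0. For t > 0 let ρ_t = diag(1,…,1, 1/t) ∈ GL_{n+1}(ℝ), and let R(θ) ∈ M_{n+1}(ℝ) be the matrix equal to the identity except in the 2×2 block in rows and columns n−1, n, where it equals [[cos θ, sin θ], [−sin θ, cos θ]]. Then ρ_t · R(θ(t)) · ρ_t^{−1} converges, as t → 0⁺, to the matrix L equal to the identity except for the entry L_{n, n−1} = −θ′(0). -/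
open Matrix

/-- The projective rescaling `ρ_t = diag(1,…,1,1/t)`. -/
noncomputable def rhoN (n : ℕ) (t : ℝ) : Matrix (Fin (n + 1)) (Fin (n + 1)) ℝ :=
  Matrix.diagonal fun i => if (i : ℕ) = n then 1 / t else 1

/-- The rotation `R(θ)`: the identity except for the 2×2 block
`[[cos θ, sin θ], [-sin θ, cos θ]]` in rows and columns `n-1, n`. -/
noncomputable def Rrot (n : ℕ) (θ : ℝ) : Matrix (Fin (n + 1)) (Fin (n + 1)) ℝ :=
  Matrix.of fun i j =>
    if (i : ℕ) = n - 1 ∧ (j : ℕ) = n - 1 then Real.cos θ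
    else if (i : ℕ) = n - 1 ∧ (j : ℕ) = n then Real.sin θ
    else if (i : ℕ) = n ∧ (j : ℕ) = n - 1 then -Real.sin θ
    else if (i : ℕ) = n ∧ (j : ℕ) = n then Real.cos θ
    else if i = j then 1 else 0

/-- Conjugating by the invertible rescaling `ρ_t` multiplies the entry in row `i` and column `j`
by the quotient of the diagonal entries. -/
theorem rhoN_mul_mul_inv_apply (n : ℕ) {t : ℝ} (ht : t ≠ 0)
    (A : Matrix (Fin (n + 1)) (Fin (n + 1)) ℝ) (i j : Fin (n + 1)) :
    (rhoN n t * A * (rhoN n t)⁻¹) i j =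
      (if (i : ℕ) = n then 1 / t else 1) * A i j * (if (j : ℕ) = n then t else 1) := by
  have hinv : (rhoN n t)⁻¹ =
      Matrix.diagonal fun i : Fin (n + 1) => if (i : ℕ) = n then t else 1 := by
    refine Matrix.inv_eq_right_inv ?_
    rw [rhoN, Matrix.diagonal_mul_diagonal, ← Matrix.diagonal_one]
    congr 1
    ext i
    split_ifs <;> simp [ht]
  rw [hinv, rhoN, Matrix.mul_diagonal, Matrix.diagonal_mul]

/-- Rescaled limit of rotations: if `θ(0) = 0` and `θ` is differentiable at `0`, then
`ρ_t · R(θ(t)) · ρ_t⁻¹ → L` as `t → 0⁺`, where `L` is the identity except for the entry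
`L_{n,n-1} = -θ'(0)` (an infinitesimal rotation in the half-pipe group). -/
theorem rescaled_limit_of_rotations (n : ℕ) (hn : 2 ≤ n) (θ : ℝ → ℝ) (θ' : ℝ)
    (hθ : HasDerivAt θ θ' 0) (hθ0 : θ 0 = 0) :
    Filter.Tendsto (fun t : ℝ => rhoN n t * Rrot n (θ t) * (rhoN n t)⁻¹)
      (nhdsWithin 0 (Set.Ioi 0))
      (nhds (Matrix.of fun i j : Fin (n + 1) =>
        if i = j then 1 else if (i : ℕ) = n ∧ (j : ℕ) = n - 1 then -θ' else 0)) := by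
  have hcos : Filter.Tendsto (fun t => Real.cos (θ t)) (nhdsWithin 0 (Set.Ioi 0)) (nhds 1) := by
    have h := (Real.continuous_cos.continuousAt.comp hθ.continuousAt).tendsto
    simp only [Function.comp_apply, hθ0, Real.cos_zero] at h
    exact h.mono_left nhdsWithin_le_nhds
  have hsin : Filter.Tendsto (fun t => Real.sin (θ t)) (nhdsWithin 0 (Set.Ioi 0)) (nhds 0) := by
    have h := (Real.continuous_sin.continuousAt.comp hθ.continuousAt).tendsto
    simp only [Function.comp_apply, hθ0, Real.sin_zero] at h
    exact h.mono_left nhdsWithin_le_nhds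
  have hid : Filter.Tendsto (fun t : ℝ => t) (nhdsWithin 0 (Set.Ioi 0)) (nhds 0) :=
    nhdsWithin_le_nhds
  have hslope : Filter.Tendsto (fun t => t⁻¹ * Real.sin (θ t)) (nhdsWithin 0 (Set.Ioi 0))
      (nhds θ') := by
    have h := hθ.sin.tendsto_slope_zero_right
    simpa [hθ0] using h
  have hpos : ∀ᶠ t : ℝ in nhdsWithin 0 (Set.Ioi 0), t ≠ 0 := by
    filter_upwards [self_mem_nhdsWithin] with t ht using ne_of_gt ht
  refine tendsto_pi_nhds.2 fun i => tendsto_pi_nhds.2 fun j => ?_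
  refine Filter.Tendsto.congr' (f₁ := fun t =>
    (if (i : ℕ) = n then 1 / t else 1) * Rrot n (θ t) i j * (if (j : ℕ) = n then t else 1)) ?_ ?_
  · filter_upwards [hpos] with t ht using (rhoN_mul_mul_inv_apply n ht _ i j).symm
  have hne : n - 1 ≠ n := by omega
  simp only [Rrot, Matrix.of_apply, Fin.ext_iff]
  by_cases hi : (i : ℕ) = n
  · by_cases hj : (j : ℕ) = n
    · simp only [hi, hj, hne.symm, false_and, and_self, and_false, if_true, if_false]
      refine hcos.congr' ?_
      filter_upwards [hpos] with t ht
      field_simp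
    · by_cases hj' : (j : ℕ) = n - 1
      · simpa [hi, hj', hne, hne.symm] using hslope.neg
      · simp [hi, hj, hj', hne.symm, Ne.symm hj]
  · by_cases hj : (j : ℕ) = n
    · by_cases hi' : (i : ℕ) = n - 1
      · simpa [hi', hj, hne, hne.symm] using hsin.mul hid
      · simp [hi, hi', hj]
    · by_cases hi' : (i : ℕ) = n - 1
      · by_cases hj' : (j : ℕ) = n - 1
        · simpa [hi', hj', hne] using hcos
        · simp [hi', hj, hj', hne]
      · simp [hi, hi', hj]
end

section
/- Fix ε₁, ε₂, ε₃, ε₄ ∈ {−1, +1}. For t ∈ (−1,1)∖{0} define α(t) = (1 + t|t|)^{−1/2}·(−√2, ε₁, ε₂, ε₃, ε₄t) ∈ ℝ⁵, J_t = diag(−1,1,1,1, sgn(t)) ∈ M₅(ℝ), R(t) = I₅ − 2·J_t·α(t)·α(t)ᵀ ∈ M₅(ℝ), and ρ_{|t|} = diag(1,1,1,1,1/|t|). Then the map t ↦ ρ_{|t|}·R(t)·ρ_{|t|}^{−1}, defined for t ∈ (−1,1)∖{0}, extends to a C¹ map M : (−1,1) → M₅(ℝ), with M(0) = I₅ − 2·u·wᵀ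 where u = (√2, ε₁, ε₂, ε₃, ε₄)ᵀ and w = (−√2, ε₁, ε₂, ε₃, 0)ᵀ. -/
open Matrix

/-- The normalised covector `α(t) = (1+t|t|)^{-1/2}·(-√2, ε₁, ε₂, ε₃, ε₄t)`. -/
noncomputable def alphaKS (ε₁ ε₂ ε₃ ε₄ t : ℝ) : Fin 5 → ℝ :=
  (Real.sqrt (1 + t * |t|))⁻¹ • ![-Real.sqrt 2, ε₁, ε₂, ε₃, ε₄ * t]

/-- The matrix `J_t = diag(-1,1,1,1,sgn(t))`. -/
noncomputable def JtKS (t : ℝ) : Matrix (Fin 5) (Fin 5) ℝ :=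
  Matrix.diagonal ![-1, 1, 1, 1, Real.sign t]

/-- The reflection `R(t) = I₅ - 2·J_t·α(t)·α(t)ᵀ`. -/
noncomputable def RKS (ε₁ ε₂ ε₃ ε₄ t : ℝ) : Matrix (Fin 5) (Fin 5) ℝ :=
  1 - (2 : ℝ) • (JtKS t * Matrix.vecMulVec (alphaKS ε₁ ε₂ ε₃ ε₄ t) (alphaKS ε₁ ε₂ ε₃ ε₄ t))

/-- The rescaling `ρ_{|t|} = diag(1,1,1,1,1/|t|)`. -/
noncomputable def rhoKS (t : ℝ) : Matrix (Fin 5) (Fin 5) ℝ :=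
  Matrix.diagonal ![1, 1, 1, 1, (|t|)⁻¹]

theorem hasDerivAt_mul_abs_self (x : ℝ) : HasDerivAt (fun t : ℝ => t * |t|) (2 * |x|) x := by
  rcases lt_trichotomy x 0 with hx | rfl | hx
  · refine ((hasDerivAt_id x).mul (hasDerivAt_abs_neg hx)).congr_deriv ?_
    rw [abs_of_neg hx, id_eq]
    ring
  · rw [hasDerivAt_iff_tendsto_slope_zero]
    have h : Filter.Tendsto (fun t : ℝ => |t|) (nhdsWithin 0 {0}ᶜ) (nhds (2 * |0|)) := by
      have h₀ : Filter.Tendsto (fun t : ℝ => |t|) (nhds 0) (nhds |0|) := continuous_abs.tendsto 0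
      simpa using h₀.mono_left nhdsWithin_le_nhds
    refine h.congr' ?_
    filter_upwards [self_mem_nhdsWithin] with t ht
    have ht' : t ≠ 0 := ht
    simp [ht']
  · refine ((hasDerivAt_id x).mul (hasDerivAt_abs_pos hx)).congr_deriv ?_
    rw [abs_of_pos hx, id_eq]
    ring

theorem contDiff_one_mul_abs_self : ContDiff ℝ 1 (fun t : ℝ => t * |t|) := by
  rw [contDiff_one_iff_deriv]
  refine ⟨fun x => (hasDerivAt_mul_abs_self x).differentiableAt, ?_⟩
  rw [funext fun x => (hasDerivAt_mul_abs_self x).deriv]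
  fun_prop

theorem one_add_mul_abs_self_pos {t : ℝ} (ht : -1 < t) : 0 < 1 + t * |t| := by
  rcases abs_cases t with ⟨h, h'⟩ | ⟨h, h'⟩ <;> rw [h] <;> nlinarith

theorem inv_rhoKS {t : ℝ} (ht : t ≠ 0) :
    (rhoKS t)⁻¹ = Matrix.diagonal ![1, 1, 1, 1, |t|] := by
  apply Matrix.inv_eq_right_inv
  rw [rhoKS, Matrix.diagonal_mul_diagonal, ← Matrix.diagonal_one]
  congr 1
  funext i
  fin_cases i <;> simp [ht]

/-- The `C¹` extension `t ↦ I₅ - 2(1 + t|t|)⁻¹·u·w(t)ᵀ` of the rescaled reflections, where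
`u = (√2, ε₁, ε₂, ε₃, ε₄)` and `w(t) = (-√2, ε₁, ε₂, ε₃, ε₄t|t|)`. -/
noncomputable def rescaledReflection (ε₁ ε₂ ε₃ ε₄ t : ℝ) : Matrix (Fin 5) (Fin 5) ℝ :=
  1 - (2 * (1 + t * |t|)⁻¹) • Matrix.vecMulVec
    ![Real.sqrt 2, ε₁, ε₂, ε₃, ε₄] ![-Real.sqrt 2, ε₁, ε₂, ε₃, ε₄ * (t * |t|)]

theorem contDiffOn_rescaledReflection_apply (ε₁ ε₂ ε₃ ε₄ : ℝ) (i j : Fin 5) :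
    ContDiffOn ℝ 1 (fun t => rescaledReflection ε₁ ε₂ ε₃ ε₄ t i j) (Set.Ioo (-1 : ℝ) 1) := by
  have hf : ContDiffOn ℝ 1 (fun t : ℝ => t * |t|) (Set.Ioo (-1 : ℝ) 1) :=
    contDiff_one_mul_abs_self.contDiffOn
  have hinv : ContDiffOn ℝ 1 (fun t : ℝ => (1 + t * |t|)⁻¹) (Set.Ioo (-1 : ℝ) 1) :=
    (contDiffOn_const.add hf).inv fun t ht => (one_add_mul_abs_self_pos ht.1).ne'
  have hw : ContDiffOn ℝ 1
      (fun t : ℝ => ![-Real.sqrt 2, ε₁, ε₂, ε₃, ε₄ * (t * |t|)] j) (Set.Ioo (-1 : ℝ) 1) := by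
    fin_cases j
    iterate 4 exact contDiffOn_const
    exact contDiffOn_const.mul hf
  exact contDiffOn_const.sub ((contDiffOn_const.mul hinv).mul (contDiffOn_const.mul hw))

theorem rescaledReflection_eq_conj (ε₁ ε₂ ε₃ ε₄ : ℝ) {t : ℝ} (ht : -1 < t) (h₀ : t ≠ 0) :
    rescaledReflection ε₁ ε₂ ε₃ ε₄ t = rhoKS t * RKS ε₁ ε₂ ε₃ ε₄ t * (rhoKS t)⁻¹ := by
  have hpos := one_add_mul_abs_self_pos ht
  have hinv : (1 + t * |t|)⁻¹ = (Real.sqrt (1 + t * |t|))⁻¹ * (Real.sqrt (1 + t * |t|))⁻¹ := by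
    rw [← mul_inv, Real.mul_self_sqrt hpos.le]
  have habs : |t| ≠ 0 := abs_ne_zero.mpr h₀
  have hsign : Real.sign t * t = |t| := by
    rcases h₀.lt_or_gt with h | h
    · simp [Real.sign_of_neg h, abs_of_neg h]
    · simp [Real.sign_of_pos h, abs_of_pos h]
  rw [inv_rhoKS h₀, rescaledReflection, hinv]
  have hsign' : |t|⁻¹ * (Real.sign t * t) = 1 := by rw [hsign, inv_mul_cancel₀ habs]
  have hcol : ∀ i, ![Real.sqrt 2, ε₁, ε₂, ε₃, ε₄] i = ![1, 1, 1, 1, |t|⁻¹] i *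
      (![-1, 1, 1, 1, Real.sign t] i * ![-Real.sqrt 2, ε₁, ε₂, ε₃, ε₄ * t] i) := by
    intro i
    fin_cases i <;> simp
    linear_combination -ε₄ * hsign'
  have hrow : ∀ j, ![-Real.sqrt 2, ε₁, ε₂, ε₃, ε₄ * (t * |t|)] j =
      ![-Real.sqrt 2, ε₁, ε₂, ε₃, ε₄ * t] j * ![1, 1, 1, 1, |t|] j := by
    intro j
    fin_cases j <;> simp [mul_assoc]
  have hone : ∀ i, ![1, 1, 1, 1, |t|⁻¹] i * ![1, 1, 1, 1, |t|] i = 1 := by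
    intro i
    fin_cases i <;> simp [habs]
  ext i j
  rw [Matrix.mul_diagonal, rhoKS, Matrix.diagonal_mul, RKS, JtKS, alphaKS]
  simp only [Matrix.sub_apply, Matrix.smul_apply, Matrix.diagonal_mul, Matrix.vecMulVec_apply,
    Pi.smul_apply, smul_eq_mul]
  rw [hcol i, hrow j]
  have hdiag : (1 : Matrix (Fin 5) (Fin 5) ℝ) i j =
      ![1, 1, 1, 1, |t|⁻¹] i * (1 : Matrix (Fin 5) (Fin 5) ℝ) i j * ![1, 1, 1, 1, |t|] j := by
    rcases eq_or_ne i j with rfl | h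
    · rw [Matrix.one_apply_eq, mul_one, hone]
    · simp [Matrix.one_apply_ne h]
  linear_combination hdiag

/-- The rescaled conjugated reflections `ρ_{|t|}·R(t)·ρ_{|t|}⁻¹` in the timelike bounding
hyperplanes `𝔪ᵢ` of the Kerckhoff–Storm polytope extend to a `C¹` path of matrices through
`t = 0`, with value `I₅ - 2·u·wᵀ` at `t = 0`. -/
theorem reflections_timelike_walls_C1 (ε₁ ε₂ ε₃ ε₄ : ℝ)
    (h₁ : ε₁ = 1 ∨ ε₁ = -1) (h₂ : ε₂ = 1 ∨ ε₂ = -1)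
    (h₃ : ε₃ = 1 ∨ ε₃ = -1) (h₄ : ε₄ = 1 ∨ ε₄ = -1) :
    ∃ M : ℝ → Matrix (Fin 5) (Fin 5) ℝ,
      (∀ i j : Fin 5, ContDiffOn ℝ 1 (fun t => M t i j) (Set.Ioo (-1 : ℝ) 1)) ∧
      (∀ t ∈ Set.Ioo (-1 : ℝ) 1, t ≠ 0 →
        M t = rhoKS t * RKS ε₁ ε₂ ε₃ ε₄ t * (rhoKS t)⁻¹) ∧
      M 0 = 1 - (2 : ℝ) • Matrix.vecMulVec
        ![Real.sqrt 2, ε₁, ε₂, ε₃, ε₄] ![-Real.sqrt 2, ε₁, ε₂, ε₃, 0] := by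
  refine ⟨rescaledReflection ε₁ ε₂ ε₃ ε₄,
    contDiffOn_rescaledReflection_apply ε₁ ε₂ ε₃ ε₄,
    fun t ht h₀ => rescaledReflection_eq_conj ε₁ ε₂ ε₃ ε₄ ht.1 h₀, ?_⟩
  simp [rescaledReflection]
end

section
/- Let c ∈ (−1, 1/3]. Suppose x = (x₀, x₁, x₂, x₃, x₄) ∈ ℝ⁵ satisfies the eight inequalities: −√2x₀+x₁+x₂+x₃+x₄ ≤ 0; −√2x₀+x₁+x₂−x₃−x₄ ≤ 0; −√2x₀+x₁+x₂+x₃−c·x₄ ≤ 0; −√2x₀+x₁+x₂−x₃+c·x₄ ≤ 0; −x₀+√2x₁ ≤ 0; −x₁+x₂ ≤ 0; −x₂+x₃ ≤ 0; −x₂−x₃ ≤ 0. If moreover x₀ ≤ 0, then x = 0. -/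
/-- Every point of the cone over the fundamental domain `𝔯_{|t|}(𝒬̄_t)` of the rescaled
Kerckhoff–Storm polytope with `x₀ ≤ 0` is zero; hence the polytope lies in the affine
chart `{x₀ > 0}`. Here `c = t|t|` for `t ∈ (-1, 1/√3]`, so `c ∈ (-1, 1/3]`. -/
theorem fundamental_domain_in_affine_chart (c : ℝ) (hc : c ∈ Set.Ioc (-1 : ℝ) (1 / 3))
    (x₀ x₁ x₂ x₃ x₄ : ℝ)
    (h1 : -Real.sqrt 2 * x₀ + x₁ + x₂ + x₃ + x₄ ≤ 0)
    (h2 : -Real.sqrt 2 * x₀ + x₁ + x₂ - x₃ - x₄ ≤ 0)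
    (h3 : -Real.sqrt 2 * x₀ + x₁ + x₂ + x₃ - c * x₄ ≤ 0)
    (h4 : -Real.sqrt 2 * x₀ + x₁ + x₂ - x₃ + c * x₄ ≤ 0)
    (h5 : -x₀ + Real.sqrt 2 * x₁ ≤ 0)
    (h6 : -x₁ + x₂ ≤ 0)
    (h7 : -x₂ + x₃ ≤ 0)
    (h8 : -x₂ - x₃ ≤ 0)
    (h0 : x₀ ≤ 0) :
    x₀ = 0 ∧ x₁ = 0 ∧ x₂ = 0 ∧ x₃ = 0 ∧ x₄ = 0 := by
  have hx₁ : 0 ≤ x₁ := by linarith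
  have hmul : 0 ≤ Real.sqrt 2 * x₁ := mul_nonneg (Real.sqrt_nonneg 2) hx₁
  obtain rfl : x₀ = 0 := by linarith
  obtain rfl : x₁ = 0 := by
    have h : Real.sqrt 2 * x₁ = 0 := by linarith
    exact (mul_eq_zero.mp h).resolve_left (by positivity)
  refine ⟨rfl, rfl, ?_, ?_, ?_⟩ <;> linarith
end

section
/- Let c ∈ (−1, 1/3]. Suppose x = (x₀, x₁, x₂, x₃, x₄) ∈ ℝ⁵ satisfies x₀ > 0, the eight inequalities −√2x₀+x₁+x₂+x₃+x₄ ≤ 0, −√2x₀+x₁+x₂−x₃−x₄ ≤ 0, −√2x₀+x₁+x₂+x₃−c·x₄ ≤ 0, −√2x₀+x₁+x₂−x₃+c·x₄ ≤ 0, −x₀+√2x₁ ≤ 0, −x₁+x₂ ≤ 0, −x₂+x₃ ≤ 0, −x₂−x₃ ≤ 0, and the equation −x₀² + x₁² + x₂² + x₃² + c·x₄² = 0. Then x₁ = x₂ = (√2/2)·x₀ and x₃ = x₄ = 0; that is, x is a positive multiple of (2, √2, √2, 0, 0). -/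
/-- In the coordinates `x₀ = √2 s`, `x₁ = s - a`, `x₂ = s - b`, a point of the domain with
`x₃ = v ≥ 0` and `x₄ = -y` lying on the quadric for a negative `c` has `b = 0`. -/
theorem eq_zero_of_quadric_of_neg {c s a b v y : ℝ} (hc₁ : -1 < c) (hc₀ : c < 0)
    (ha : 0 ≤ a) (hab : a ≤ b) (hv : 0 ≤ v) (hvb : v ≤ s - b)
    (h : v + c * y ≤ a + b)
    (hq : (s - a) ^ 2 + (s - b) ^ 2 + v ^ 2 + c * y ^ 2 = 2 * s ^ 2) : b = 0 := by
  by_contra hb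
  have hb' : 0 < b := lt_of_le_of_ne (ha.trans hab) (Ne.symm hb)
  have hm : 0 < (a + b) * (s - v) := mul_pos (by linarith) (by linarith)
  rcases le_total v (a + b) with hvm | hvm
  · have h₁ : c * y ^ 2 ≤ 0 := mul_nonpos_of_nonpos_of_nonneg hc₀.le (sq_nonneg y)
    have h₂ : 0 ≤ v * (a + b - v) := mul_nonneg hv (by linarith)
    have h₃ : 0 ≤ a * (s - a) := mul_nonneg ha (by linarith)
    have h₄ : 0 ≤ b * (s - b) := mul_nonneg hb'.le (by linarith)
    nlinarith
  · have h₁ : (v - (a + b)) ^ 2 ≤ (c * y) ^ 2 := by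
      rw [← neg_sq (c * y)]
      exact pow_le_pow_left₀ (by linarith) (by linarith) 2
    have h₂ : 0 ≤ -c * y ^ 2 * (1 + c) :=
      mul_nonneg (mul_nonneg (by linarith) (sq_nonneg y)) (by linarith)
    have h₃ : 0 ≤ a * b := mul_nonneg ha hb'.le
    nlinarith

/-- In the coordinates `x₀ = √2 s`, `x₁ = s - a`, `x₂ = s - b`, a point of the domain with
`x₃ = v ≥ 0` and `x₄ = -y` lying on the quadric for `0 ≤ c ≤ 1 / 3` has `b = 0`. -/
theorem eq_zero_of_quadric_of_nonneg {c s a b v y : ℝ} (hc₀ : 0 ≤ c) (hc₁ : c ≤ 1 / 3)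
    (ha : 0 ≤ a) (hab : a ≤ b) (hv : 0 ≤ v) (hvb : v ≤ s - b)
    (hy : y - v ≤ a + b) (hy' : v - y ≤ a + b) (h : v + c * y ≤ a + b)
    (hq : (s - a) ^ 2 + (s - b) ^ 2 + v ^ 2 + c * y ^ 2 = 2 * s ^ 2) : b = 0 := by
  by_contra hb
  have hb' : 0 < b := lt_of_le_of_ne (ha.trans hab) (Ne.symm hb)
  have hbb : 0 < b * b := mul_pos hb' hb'
  have hab' : 0 ≤ a * (b - a) := mul_nonneg ha (by linarith)
  have habs : |y| ≤ a + b + v := abs_le.2 ⟨by linarith, by linarith⟩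
  rcases le_total v ((a + b) / 2) with hvm | hvm
  · have h₁ : y ^ 2 ≤ (a + b + v) ^ 2 := sq_le_sq' (by linarith) (by linarith)
    have h₂ : c * y ^ 2 ≤ 1 / 3 * (a + b + v) ^ 2 :=
      mul_le_mul hc₁ h₁ (sq_nonneg y) (by norm_num)
    have h₃ : 0 ≤ v * ((a + b) / 2 - v) := mul_nonneg hv (by linarith)
    have h₄ : 0 ≤ (a + b) * (s - b - v) := mul_nonneg (by linarith) (by linarith)
    have h₅ : 0 ≤ (a + b) * (s - b) := mul_nonneg (by linarith) (by linarith)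
    nlinarith
  · have hcy : c * |y| ≤ a + b - v := by
      rcases le_total 0 y with hy₀ | hy₀
      · rw [abs_of_nonneg hy₀]; linarith
      · rw [abs_of_nonpos hy₀]
        have := mul_nonneg (sub_nonneg.2 hc₁) (neg_nonneg.2 hy₀)
        linarith
    have h₁ : c * |y| * |y| ≤ (a + b - v) * (a + b + v) :=
      mul_le_mul hcy habs (abs_nonneg y) ((mul_nonneg hc₀ (abs_nonneg y)).trans hcy)
    rw [mul_assoc, abs_mul_abs_self] at h₁
    have h₂ : 0 ≤ (a + b) * (s - b - (a + b) / 2) := mul_nonneg (by linarith) (by linarith)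
    nlinarith

/-- A point of the domain on the quadric, in the coordinates `x₀ = √2 s`, `x₁ = s - a`,
`x₂ = s - b`, has `b = 0`. -/
theorem eq_zero_of_quadric {c s a b v y : ℝ} (hc : c ∈ Set.Ioc (-1 : ℝ) (1 / 3))
    (ha : 0 ≤ a) (hab : a ≤ b) (hvb : |v| ≤ s - b)
    (hy : |v - y| ≤ a + b) (h : |v + c * y| ≤ a + b)
    (hq : (s - a) ^ 2 + (s - b) ^ 2 + v ^ 2 + c * y ^ 2 = 2 * s ^ 2) : b = 0 := by
  wlog hv : 0 ≤ v generalizing v y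
  · refine this (v := -v) (y := -y) (by rwa [abs_neg]) ?_ ?_ (by rwa [neg_sq, neg_sq])
      (by linarith)
    · rwa [neg_sub_neg, abs_sub_comm]
    · rwa [mul_neg, ← neg_add, abs_neg]
  rw [abs_of_nonneg hv] at hvb
  obtain ⟨hy₁, hy₂⟩ := abs_le.1 hy
  obtain ⟨-, h₂⟩ := abs_le.1 h
  rcases lt_or_ge c 0 with hc₀ | hc₀
  · exact eq_zero_of_quadric_of_neg hc.1 hc₀ ha hab hv hvb h₂ hq
  · exact eq_zero_of_quadric_of_nonneg hc₀ hc.2 ha hab hv hvb (by linarith) hy₂ h₂ hq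

/-- The fundamental domain `𝔯_{|t|}(𝒬̄_t)` of the rescaled Kerckhoff–Storm polytope meets
the boundary quadric `-x₀² + x₁² + x₂² + x₃² + c·x₄² = 0` (with `c = t|t|`) only in the
single ideal vertex `[2 : √2 : √2 : 0 : 0]`. -/
theorem fundamental_domain_unique_ideal_point (c : ℝ) (hc : c ∈ Set.Ioc (-1 : ℝ) (1 / 3))
    (x₀ x₁ x₂ x₃ x₄ : ℝ) (hx0 : 0 < x₀)
    (h1 : -Real.sqrt 2 * x₀ + x₁ + x₂ + x₃ + x₄ ≤ 0)
    (h2 : -Real.sqrt 2 * x₀ + x₁ + x₂ - x₃ - x₄ ≤ 0)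
    (h3 : -Real.sqrt 2 * x₀ + x₁ + x₂ + x₃ - c * x₄ ≤ 0)
    (h4 : -Real.sqrt 2 * x₀ + x₁ + x₂ - x₃ + c * x₄ ≤ 0)
    (h5 : -x₀ + Real.sqrt 2 * x₁ ≤ 0)
    (h6 : -x₁ + x₂ ≤ 0)
    (h7 : -x₂ + x₃ ≤ 0)
    (h8 : -x₂ - x₃ ≤ 0)
    (hq : -x₀ ^ 2 + x₁ ^ 2 + x₂ ^ 2 + x₃ ^ 2 + c * x₄ ^ 2 = 0) :
    (x₁ = Real.sqrt 2 / 2 * x₀ ∧ x₂ = Real.sqrt 2 / 2 * x₀ ∧ x₃ = 0 ∧ x₄ = 0) ∧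
    (∃ r : ℝ, 0 < r ∧ x₀ = 2 * r ∧ x₁ = Real.sqrt 2 * r ∧ x₂ = Real.sqrt 2 * r ∧
      x₃ = 0 ∧ x₄ = 0) := by
  have hsq : Real.sqrt 2 * Real.sqrt 2 = 2 := Real.mul_self_sqrt (by norm_num)
  have hpos : 0 < Real.sqrt 2 := Real.sqrt_pos.2 (by norm_num)
  obtain ⟨s, rfl⟩ : ∃ s, x₀ = Real.sqrt 2 * s :=
    ⟨x₀ / Real.sqrt 2, (mul_div_cancel₀ x₀ hpos.ne').symm⟩
  have hs : 0 < s := pos_of_mul_pos_right hx0 hpos.le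
  have hx₁ : x₁ ≤ s := le_of_mul_le_mul_left (by linarith) hpos
  have hss : Real.sqrt 2 * (Real.sqrt 2 * s) = 2 * s := by rw [← mul_assoc, hsq]
  rw [neg_mul, hss] at h1 h2 h3 h4
  have hb : s - x₂ = 0 := by
    refine eq_zero_of_quadric (s := s) (a := s - x₁) (v := x₃) (y := -x₄) hc (by linarith)
      (by linarith) (abs_le.2 ⟨by linarith, by linarith⟩)
      (abs_le.2 ⟨by linarith, by linarith⟩) (abs_le.2 ⟨by linarith, by linarith⟩) ?_
    rw [mul_pow, Real.sq_sqrt (by norm_num)] at hq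
    linear_combination hq
  have h₂ : x₂ = s := by linarith
  have h₁ : x₁ = s := by linarith
  have h₄ : x₄ = 0 := by
    refine (mul_eq_zero.1 (?_ : (1 + c) * x₄ = 0)).resolve_left (by linarith [hc.1])
    linarith
  have h₃ : x₃ = 0 := by linarith
  have hhalf : s = Real.sqrt 2 / 2 * (Real.sqrt 2 * s) := by linarith
  refine ⟨⟨h₁.trans hhalf, h₂.trans hhalf, h₃, h₄⟩, Real.sqrt 2 / 2 * s, by positivity,
    by ring, ?_, ?_, h₃, h₄⟩ <;> linarith
end

section
/- Let c ∈ (−1, 0]. Then the set S_c = {(y₁,y₂,y₃,y₄) ∈ ℝ⁴ : −√2+y₁+y₂+y₃+y₄ ≤ 0, −√2+y₁+y₂−y₃−y₄ ≤ 0, −√2+y₁+y₂+y₃−c·y₄ ≤ 0, −√2+y₁+y₂−y₃+c·y₄ ≤ 0, −1+√2y₁ ≤ 0, y₂ ≤ y₁, y₃ ≤ y₂, −y₃ ≤ y₂} is the convex hull of the following 13 points: (√2/2, √2/2, 0, 0); (√2/2, √2/4, √2/4, 0); (√2/3, √2/3, √2/3, 0); (√2/2, (√2/4)(1−c), −(√2/4)(1−c),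 √2/2); (√2(1−c)/(3−c), √2(1−c)/(3−c), −√2(1−c)/(3−c), 2√2/(3−c)); (√2/2, 0, 0, √2/2); (0, 0, 0, √2); (√2/2, (√2/4)(1−c), (√2/4)(1−c), −√2/2); (√2(1−c)/(3−c), √2(1−c)/(3−c), √2(1−c)/(3−c), −2√2/(3−c)); (√2/2, √2/4, −√2/4, 0); (√2/3, √2/3, −√2/3, 0); (√2/2, 0, 0, −√2/2); (0, 0, 0, −√2). -/
/-- A convex set contains every convex combination of five of its points. -/
theorem Convex.sum_five_mem {E : Type*} [AddCommGroup E] [Module ℝ E] {S : Set E}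
    (hS : Convex ℝ S) {x₁ x₂ x₃ x₄ x₅ : E} (h₁ : x₁ ∈ S) (h₂ : x₂ ∈ S) (h₃ : x₃ ∈ S)
    (h₄ : x₄ ∈ S) (h₅ : x₅ ∈ S) {a₁ a₂ a₃ a₄ a₅ : ℝ} (ha₁ : 0 ≤ a₁) (ha₂ : 0 ≤ a₂)
    (ha₃ : 0 ≤ a₃) (ha₄ : 0 ≤ a₄) (ha₅ : 0 ≤ a₅) (hsum : a₁ + a₂ + a₃ + a₄ + a₅ = 1) :
    a₁ • x₁ + a₂ • x₂ + a₃ • x₃ + a₄ • x₄ + a₅ • x₅ ∈ S := by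
  have h := hS.sum_mem (t := Finset.univ) (w := ![a₁, a₂, a₃, a₄, a₅])
    (z := ![x₁, x₂, x₃, x₄, x₅])
    (by intro i _; fin_cases i <;> simpa)
    (by simpa [Fin.sum_univ_five] using hsum)
    (by intro i _; fin_cases i <;> simpa)
  simpa [Fin.sum_univ_five] using h

/-- A triangulation of the polytope cut out of the orthant `p, q, r, s ≥ 0` by
`3p + q + r + s ≤ 1`, `p + 3q + r ≤ 1 + ds` and `p + q + r ≤ 1/2`, with its eleven vertices
expressed in arbitrary vectors `P, Q, R, T`: a convex set containing the vertices contains the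
whole polytope. -/
theorem Convex.orthant_polytope_mem {E : Type*} [AddCommGroup E] [Module ℝ E] {S : Set E}
    (hS : Convex ℝ S) {d : ℝ} (hd₀ : 0 ≤ d) (hd₁ : d < 1) {P Q R T : E}
    (h_zero : (0 : E) ∈ S)
    (hPQ : (1 / 4 : ℝ) • P + (1 / 4 : ℝ) • Q ∈ S)
    (hPR : (1 / 4 : ℝ) • P + (1 / 4 : ℝ) • R ∈ S)
    (hP : (1 / 3 : ℝ) • P ∈ S)
    (hQR : (1 / 4 : ℝ) • Q + (1 / 4 : ℝ) • R ∈ S)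
    (hQ : (1 / 3 : ℝ) • Q ∈ S)
    (hR : (1 / 2 : ℝ) • R ∈ S)
    (hQRT : ((1 + d) / 4) • Q + ((1 - d) / 4) • R + (1 / 2 : ℝ) • T ∈ S)
    (hQT : ((1 + d) / (3 + d)) • Q + (2 / (3 + d)) • T ∈ S)
    (hRT : (1 / 2 : ℝ) • R + (1 / 2 : ℝ) • T ∈ S)
    (hT : T ∈ S)
    {p q r s : ℝ} (hp : 0 ≤ p) (hq : 0 ≤ q) (hr : 0 ≤ r) (hs : 0 ≤ s)
    (h₁ : 3 * p + q + r + s ≤ 1) (h₂ : p + 3 * q + r ≤ 1 + d * s) (h₃ : p + q + r ≤ 1 / 2) :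
    p • P + q • Q + r • R + s • T ∈ S := by
  have hd₂ : 0 < 1 + d := by linarith
  have hd₃ : 0 < 1 - d := by linarith
  have hd₄ : 0 < 3 + d := by linarith
  rcases le_total q p with hqp | hpq
  · rcases le_total r (p - q) with hrp | hpr
    · convert hS.sum_five_mem hPQ hPR hP hT h_zero (a₁ := 4 * q) (a₂ := 4 * r)
        (a₃ := 3 * (p - q - r)) (a₄ := s) (a₅ := 1 - 4 * q - 4 * r - 3 * (p - q - r) - s)
        (by linarith) (by linarith) (by linarith) (by linarith) (by linarith) (by ring) using 1
      module
    · rcases le_total s (r - (p - q)) with hsr | hrs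
      · convert hS.sum_five_mem hPQ hPR hRT hR h_zero (a₁ := 4 * q) (a₂ := 4 * (p - q))
          (a₃ := 2 * s) (a₄ := 2 * (r - (p - q) - s)) (a₅ := 1 - 4 * p - 2 * (r - (p - q)))
          (by linarith) (by linarith) (by linarith) (by linarith) (by linarith) (by ring) using 1
        module
      · convert hS.sum_five_mem hPQ hPR hRT hT h_zero (a₁ := 4 * q) (a₂ := 4 * (p - q))
          (a₃ := 2 * (r - (p - q))) (a₄ := s - (r - (p - q)))
          (a₅ := 1 - 4 * p - (r - (p - q)) - s)
          (by linarith) (by linarith) (by linarith) (by linarith) (by linarith) (by ring) using 1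
        module
  · obtain ⟨u, rfl⟩ : ∃ u, q = p + u := ⟨q - p, by ring⟩
    have hu : 0 ≤ u := by linarith
    -- The weight `l` of the vertex `hQRT` is the largest that keeps the remainder in the orthant.
    obtain ⟨l, hl, hlu, hlr, hls, hl_eq⟩ : ∃ l : ℝ, 0 ≤ l ∧ l * ((1 + d) / 4) ≤ u ∧
        l * ((1 - d) / 4) ≤ r ∧ l * (1 / 2) ≤ s ∧
        (u = l * ((1 + d) / 4) ∨ r = l * ((1 - d) / 4) ∨ s = l * (1 / 2)) := by
      have e₁ : u / ((1 + d) / 4) * ((1 + d) / 4) = u := div_mul_cancel₀ _ (by positivity)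
      have e₂ : r / ((1 - d) / 4) * ((1 - d) / 4) = r := div_mul_cancel₀ _ (by positivity)
      have e₃ : s / (1 / 2) * (1 / 2) = s := div_mul_cancel₀ _ (by positivity)
      refine ⟨min (u / ((1 + d) / 4)) (min (r / ((1 - d) / 4)) (s / (1 / 2))),
        by positivity, ?_, ?_, ?_, ?_⟩
      · rw [← le_div_iff₀ (by positivity)]; exact min_le_left _ _
      · rw [← le_div_iff₀ (by positivity)]
        exact (min_le_right _ _).trans (min_le_left _ _)
      · rw [← le_div_iff₀ (by positivity)]
        exact (min_le_right _ _).trans (min_le_right _ _)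
      · rcases min_choice (u / ((1 + d) / 4)) (min (r / ((1 - d) / 4)) (s / (1 / 2))) with h | h
        · left; rw [h, e₁]
        · rcases min_choice (r / ((1 - d) / 4)) (s / (1 / 2)) with h' | h'
          · right; left; rw [h, h', e₂]
          · right; right; rw [h, h', e₃]
    obtain ⟨v, rfl⟩ : ∃ v, u = v + l * ((1 + d) / 4) := ⟨u - l * ((1 + d) / 4), by ring⟩
    obtain ⟨x, rfl⟩ : ∃ x, r = x + l * ((1 - d) / 4) := ⟨r - l * ((1 - d) / 4), by ring⟩
    obtain ⟨y, rfl⟩ : ∃ y, s = y + l * (1 / 2) := ⟨s - l * (1 / 2), by ring⟩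
    have hv : 0 ≤ v := by linarith
    have hx : 0 ≤ x := by linarith
    have hy : 0 ≤ y := by linarith
    rcases hl_eq with h | h | h
    · obtain rfl : v = 0 := by linarith
      rcases le_total y x with hyx | hxy
      · convert hS.sum_five_mem hPQ hQRT hRT hR h_zero (a₁ := 4 * p) (a₂ := l)
          (a₃ := 2 * y) (a₄ := 2 * (x - y)) (a₅ := 1 - 4 * p - l - 2 * x)
          (by linarith) (by linarith) (by linarith) (by linarith) (by linarith) (by ring) using 1
        module
      · convert hS.sum_five_mem hPQ hQRT hRT hT h_zero (a₁ := 4 * p) (a₂ := l)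
          (a₃ := 2 * x) (a₄ := y - x) (a₅ := 1 - 4 * p - l - x - y)
          (by linarith) (by linarith) (by linarith) (by linarith) (by linarith) (by ring) using 1
        module
    · obtain rfl : x = 0 := by linarith
      rcases le_total ((1 + d) / 2 * y) v with hyv | hvy
      · convert hS.sum_five_mem hPQ hQRT hQT hQ h_zero (a₁ := 4 * p) (a₂ := l)
          (a₃ := (3 + d) / 2 * y) (a₄ := 3 * (v - (1 + d) / 2 * y))
          (a₅ := 1 - 4 * p - l - 3 * v + d * y)
          (by linarith) (by linarith) (by positivity) (by linarith) (by linarith) (by ring) using 1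
        match_scalars <;> field_simp <;> ring
      · obtain ⟨z, rfl⟩ : ∃ z, v = (1 + d) / 2 * z := ⟨v / ((1 + d) / 2), by field_simp⟩
        have hzy : z ≤ y := le_of_mul_le_mul_left hvy (by positivity)
        have hz : 0 ≤ z := nonneg_of_mul_nonneg_right hv (by positivity)
        convert hS.sum_five_mem hPQ hQRT hQT hT h_zero (a₁ := 4 * p) (a₂ := l)
          (a₃ := (3 + d) / 2 * z) (a₄ := y - z)
          (a₅ := 1 - 4 * p - l - (1 + d) / 2 * z - y)
          (by linarith) (by linarith) (by positivity) (by linarith) (by linarith) (by ring) using 1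
        match_scalars <;> field_simp <;> ring
    · obtain rfl : y = 0 := by linarith
      rcases le_total v x with hvx | hxv
      · convert hS.sum_five_mem hPQ hQRT hQR hR h_zero (a₁ := 4 * p) (a₂ := l)
          (a₃ := 4 * v) (a₄ := 2 * (x - v)) (a₅ := 1 - 4 * p - l - 2 * v - 2 * x)
          (by linarith) (by linarith) (by linarith) (by linarith) (by linarith) (by ring) using 1
        module
      · convert hS.sum_five_mem hPQ hQRT hQR hQ h_zero (a₁ := 4 * p) (a₂ := l)
          (a₃ := 4 * x) (a₄ := 3 * (v - x)) (a₅ := 1 - 4 * p - l - 3 * v - x)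
          (by linarith) (by linarith) (by linarith) (by linarith) (by linarith) (by ring) using 1
        module

/-- For `c = t|t| ∈ (-1,0]` (the Anti-de Sitter/half-pipe range), the fundamental domain
`𝔯_{|t|}(𝒬̄_t)` of the rescaled Kerckhoff–Storm polytope, written in the affine coordinates
`yᵢ = xᵢ/x₀`, is the convex hull of its 13 vertices. -/
theorem fundamental_domain_is_convex_hull_of_vertices (c : ℝ)
    (hc : c ∈ Set.Ioc (-1 : ℝ) 0) :
    {y : Fin 4 → ℝ |
        -Real.sqrt 2 + y 0 + y 1 + y 2 + y 3 ≤ 0 ∧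
        -Real.sqrt 2 + y 0 + y 1 - y 2 - y 3 ≤ 0 ∧
        -Real.sqrt 2 + y 0 + y 1 + y 2 - c * y 3 ≤ 0 ∧
        -Real.sqrt 2 + y 0 + y 1 - y 2 + c * y 3 ≤ 0 ∧
        -1 + Real.sqrt 2 * y 0 ≤ 0 ∧
        y 1 ≤ y 0 ∧ y 2 ≤ y 1 ∧ -y 2 ≤ y 1} =
      convexHull ℝ
        ({![Real.sqrt 2 / 2, Real.sqrt 2 / 2, 0, 0],
          ![Real.sqrt 2 / 2, Real.sqrt 2 / 4, Real.sqrt 2 / 4, 0],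
          ![Real.sqrt 2 / 3, Real.sqrt 2 / 3, Real.sqrt 2 / 3, 0],
          ![Real.sqrt 2 / 2, Real.sqrt 2 / 4 * (1 - c), -(Real.sqrt 2 / 4 * (1 - c)),
            Real.sqrt 2 / 2],
          ![Real.sqrt 2 * (1 - c) / (3 - c), Real.sqrt 2 * (1 - c) / (3 - c),
            -(Real.sqrt 2 * (1 - c) / (3 - c)), 2 * Real.sqrt 2 / (3 - c)],
          ![Real.sqrt 2 / 2, 0, 0, Real.sqrt 2 / 2],
          ![0, 0, 0, Real.sqrt 2],
          ![Real.sqrt 2 / 2, Real.sqrt 2 / 4 * (1 - c), Real.sqrt 2 / 4 * (1 - c),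
            -(Real.sqrt 2 / 2)],
          ![Real.sqrt 2 * (1 - c) / (3 - c), Real.sqrt 2 * (1 - c) / (3 - c),
            Real.sqrt 2 * (1 - c) / (3 - c), -(2 * Real.sqrt 2 / (3 - c))],
          ![Real.sqrt 2 / 2, Real.sqrt 2 / 4, -(Real.sqrt 2 / 4), 0],
          ![Real.sqrt 2 / 3, Real.sqrt 2 / 3, -(Real.sqrt 2 / 3), 0],
          ![Real.sqrt 2 / 2, 0, 0, -(Real.sqrt 2 / 2)],
          ![0, 0, 0, -Real.sqrt 2]} : Set (Fin 4 → ℝ)) := by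
  obtain ⟨hc₁, hc₀⟩ := hc
  have hk : 0 < Real.sqrt 2 := by positivity
  have hkk : Real.sqrt 2 * Real.sqrt 2 = 2 := Real.mul_self_sqrt (by norm_num)
  have hc₃ : 0 < 3 - c := by linarith
  generalize Real.sqrt 2 = k at hk hkk ⊢
  apply Set.Subset.antisymm
  · rintro y ⟨h₁, h₂, h₃, h₄, h₅, h₆, h₇, h₈⟩
    generalize hV_eq : ({_, _, _, _, _, _, _, _, _, _, _, _, _} : Set (Fin 4 → ℝ)) = V
    have hS := convex_convexHull ℝ (s := V)
    have hV := subset_convexHull ℝ V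
    generalize convexHull ℝ V = S at hS hV ⊢
    simp only [← hV_eq, Set.insert_subset_iff, Set.singleton_subset_iff] at hV
    obtain ⟨m₁, m₂, m₃, m₄, m₅, m₆, m₇, m₈, m₉, m₁₀, m₁₁, m₁₂, m₁₃⟩ := hV
    have h_zero : (0 : Fin 4 → ℝ) ∈ S := by
      convert hS m₇ m₁₃ (a := 1 / 2) (b := 1 / 2) (by norm_num) (by norm_num) (by norm_num) using 1
      ext i; fin_cases i <;> simp
    have h_mid : ![k / 2, 0, 0, 0] ∈ S := by
      convert hS m₆ m₁₂ (a := 1 / 2) (b := 1 / 2) (by norm_num) (by norm_num) (by norm_num) using 1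
      ext i; fin_cases i <;> simp; ring
    rcases le_total 0 (y 3) with h_nonneg | h_nonpos
    · convert hS.orthant_polytope_mem (d := -c) (by linarith) (by linarith)
        (P := ![k, k, k, 0]) (Q := ![k, k, -k, 0]) (R := ![k, 0, 0, 0]) (T := ![0, 0, 0, k])
        h_zero ?_ ?_ ?_ ?_ ?_ ?_ ?_ ?_ ?_ m₇
        (p := (y 1 + y 2) / (2 * k)) (q := (y 1 - y 2) / (2 * k))
        (r := (y 0 - y 1) / k) (s := y 3 / k)
        (div_nonneg (by linarith) (by linarith)) (div_nonneg (by linarith) (by linarith))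
        (div_nonneg (by linarith) hk.le) (div_nonneg (by linarith) hk.le)
        ?_ ?_ ?_ using 1
      · ext i; fin_cases i <;> simp <;> field
      · convert m₁ using 1
        ext i; fin_cases i <;> simp <;> field
      · convert m₂ using 1
        ext i; fin_cases i <;> simp <;> field
      · convert m₃ using 1
        ext i; fin_cases i <;> simp <;> field
      · convert m₁₀ using 1
        ext i; fin_cases i <;> simp <;> field
      · convert m₁₁ using 1
        ext i; fin_cases i <;> simp <;> field
      · convert h_mid using 1
        ext i; fin_cases i <;> simp; field
      · convert m₄ using 1
        ext i; fin_cases i <;> simp <;> field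
      · convert m₅ using 1
        ext i; fin_cases i <;> simp [← sub_eq_add_neg] <;> field
      · convert m₆ using 1
        ext i; fin_cases i <;> simp <;> field
      · field_simp
        linarith
      · field_simp
        linarith
      · field_simp
        nlinarith
    · convert hS.orthant_polytope_mem (d := -c) (by linarith) (by linarith)
        (P := ![k, k, -k, 0]) (Q := ![k, k, k, 0]) (R := ![k, 0, 0, 0]) (T := ![0, 0, 0, -k])
        h_zero ?_ ?_ ?_ ?_ ?_ ?_ ?_ ?_ ?_ m₁₃
        (p := (y 1 - y 2) / (2 * k)) (q := (y 1 + y 2) / (2 * k))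
        (r := (y 0 - y 1) / k) (s := -y 3 / k)
        (div_nonneg (by linarith) (by linarith)) (div_nonneg (by linarith) (by linarith))
        (div_nonneg (by linarith) hk.le) (div_nonneg (by linarith) hk.le)
        ?_ ?_ ?_ using 1
      · ext i; fin_cases i <;> simp <;> field
      · convert m₁ using 1
        ext i; fin_cases i <;> simp <;> field
      · convert m₁₀ using 1
        ext i; fin_cases i <;> simp <;> field
      · convert m₁₁ using 1
        ext i; fin_cases i <;> simp <;> field
      · convert m₂ using 1
        ext i; fin_cases i <;> simp <;> field
      · convert m₃ using 1
        ext i; fin_cases i <;> simp <;> field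
      · convert h_mid using 1
        ext i; fin_cases i <;> simp; field
      · convert m₈ using 1
        ext i; fin_cases i <;> simp <;> field
      · convert m₉ using 1
        ext i; fin_cases i <;> simp [← sub_eq_add_neg] <;> field
      · convert m₁₂ using 1
        ext i; fin_cases i <;> simp <;> field
      · field_simp
        linarith
      · field_simp
        linarith
      · field_simp
        nlinarith
  · obtain ⟨u, hu⟩ : ∃ u, u = k / (3 - c) := ⟨_, rfl⟩
    have hu₀ : 0 < u := hu ▸ div_pos hk hc₃
    have hku : k = (3 - c) * u := by rw [hu]; field_simp
    have e₁ : k * (1 - c) / (3 - c) = u * (1 - c) := by rw [hu]; ring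
    have e₂ : 2 * k / (3 - c) = 2 * u := by rw [hu]; ring
    have hkku : k * k = (3 - c) * (k * u) := by linear_combination k * hku
    have hkc := mul_nonneg hk.le (neg_nonneg.mpr hc₀)
    have hkc' := mul_nonneg hk.le (neg_le_iff_add_nonneg'.mp hc₁.le)
    have huc := mul_nonneg hu₀.le (neg_nonneg.mpr hc₀)
    have huc' := mul_nonneg hu₀.le (neg_le_iff_add_nonneg'.mp hc₁.le)
    have hkuc := mul_nonneg (mul_pos hk hu₀).le (neg_le_iff_add_nonneg'.mp hc₁.le)
    apply convexHull_min
    · intro x hx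
      simp only [Set.mem_insert_iff, Set.mem_singleton_iff] at hx
      rcases hx with rfl | rfl | rfl | rfl | rfl | rfl | rfl | rfl | rfl | rfl | rfl | rfl | rfl
      all_goals
        simp only [Set.mem_ofPred_eq, Matrix.cons_val, e₁, e₂]
        refine ⟨?_, ?_, ?_, ?_, ?_, ?_, ?_, ?_⟩ <;> linarith
    · intro x hx y hy a b ha hb hab
      obtain ⟨h₁, h₂, h₃, h₄, h₅, h₆, h₇, h₈⟩ := hx
      obtain ⟨g₁, g₂, g₃, g₄, g₅, g₆, g₇, g₈⟩ := hy
      obtain rfl : b = 1 - a := by linarith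
      simp only [Set.mem_ofPred_eq, Pi.add_apply, Pi.smul_apply, smul_eq_mul]
      refine ⟨?_, ?_, ?_, ?_, ?_, ?_, ?_, ?_⟩
      · linear_combination a * h₁ + (1 - a) * g₁
      · linear_combination a * h₂ + (1 - a) * g₂
      · linear_combination a * h₃ + (1 - a) * g₃
      · linear_combination a * h₄ + (1 - a) * g₄
      · linear_combination a * h₅ + (1 - a) * g₅
      · linear_combination a * h₆ + (1 - a) * g₆
      · linear_combination a * h₇ + (1 - a) * g₇
      · linear_combination a * h₈ + (1 - a) * g₈
end

section
/- Let c ∈ (−1, 1/3] and let x = (x₀, x₁, x₂, x₃, x₄) ∈ ℝ⁵ be nonzero. Suppose x satisfies the following 22 inequalities: for every (ε₁, ε₂, ε₃) ∈ {−1,+1}³, both −√2x₀ + ε₁x₁ + ε₂x₂ + ε₃x₃ + ε₁ε₂ε₃·x₄ ≤ 0 and −√2x₀ + ε₁x₁ + ε₂x₂ + ε₃x₃ − ε₁ε₂ε₃·c·x₄ ≤ 0; and for every j ∈ {1,2,3}, both −x₀ + √2·x_j ≤ 0 and −x₀ − √2·x_j ≤ 0. Then x₀ > 0 and −x₀² +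 x₁² + x₂² + x₃² + c·x₄² ≤ 0. -/
/-- Two numbers in `[0, 1]` with sum at most `1 + w`, where `w ≥ 0`, have square sum at most
`1 + w ^ 2`. -/
theorem sq_add_sq_le_one_add_sq {a b w : ℝ} (ha : 0 ≤ a) (ha' : a ≤ 1) (hb : 0 ≤ b)
    (hb' : b ≤ 1) (hw : 0 ≤ w) (h : a + b ≤ 1 + w) : a ^ 2 + b ^ 2 ≤ 1 + w ^ 2 := by
  rcases le_total (a + b) 1 with h' | h'
  · nlinarith
  · nlinarith [mul_nonneg (sub_nonneg.2 ha') (sub_nonneg.2 hb')]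

/-- Three numbers in `[0, 1]` with sum at most `2 + w`, where `w ≥ 0`, have square sum at most
`2 + w ^ 2`. -/
theorem sq_add_sq_add_sq_le_two_add_sq {a b d w : ℝ} (ha : 0 ≤ a) (ha' : a ≤ 1) (hb : 0 ≤ b)
    (hb' : b ≤ 1) (hd : 0 ≤ d) (hd' : d ≤ 1) (hw : 0 ≤ w) (h : a + b + d ≤ 2 + w) :
    a ^ 2 + b ^ 2 + d ^ 2 ≤ 2 + w ^ 2 := by
  rcases le_total (b + d) 1 with h' | h'
  · nlinarith
  · have := sq_add_sq_le_one_add_sq (b := b + d - 1) ha ha' (by linarith) (by linarith) hw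
      (by linarith)
    nlinarith [mul_nonneg (sub_nonneg.2 hb') (sub_nonneg.2 hd')]

/-- The quadratic inequality on the slice `x₀ = √2` of the cone, for nonnegative `x₁, x₂, x₃`. -/
theorem quadratic_le_two_of_nonneg {c a b d y : ℝ} (hc : -1 < c) (hc' : c ≤ 1 / 3)
    (ha : 0 ≤ a) (ha' : a ≤ 1) (hb : 0 ≤ b) (hb' : b ≤ 1) (hd : 0 ≤ d) (hd' : d ≤ 1)
    (h : a + b + d + y ≤ 2) (hcy : a + b + d - c * y ≤ 2) (hab : a + b - d - y ≤ 2)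
    (had : a - b + d - y ≤ 2) (hbd : -a + b + d - y ≤ 2) :
    a ^ 2 + b ^ 2 + d ^ 2 + c * y ^ 2 ≤ 2 := by
  have hsum : a ^ 2 + b ^ 2 + d ^ 2 ≤ a + b + d := by nlinarith
  rcases le_total 0 y with hy | hy
  · have hy2 : c * y ^ 2 ≤ 1 / 3 * y ^ 2 := by gcongr
    rcases le_total y 1 with hy1 | hy1
    · nlinarith
    · have : a ^ 2 + b ^ 2 + d ^ 2 ≤ (a + b + d) ^ 2 := by
        nlinarith [mul_nonneg ha hb, mul_nonneg ha hd, mul_nonneg hb hd]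
      have : (a + b + d) ^ 2 ≤ (2 - y) ^ 2 := by
        gcongr
        linarith
      nlinarith
  · obtain ⟨z, rfl⟩ : ∃ z, y = -z := ⟨-y, (neg_neg y).symm⟩
    have hz : 0 ≤ z := by linarith
    rcases le_total z 1 with hz1 | hz1
    · rcases le_total 0 c with hc0 | hc0
      · nlinarith [mul_nonneg (mul_nonneg hc0 hz) (sub_nonneg.2 hz1)]
      · have hw : 0 ≤ -c * z := mul_nonneg (by linarith) hz
        have := sq_add_sq_add_sq_le_two_add_sq ha ha' hb hb' hd hd' hw (by linarith)
        nlinarith [mul_nonneg (mul_nonneg hw hz) (by linarith : 0 ≤ 1 + c)]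
    · have hmax : a ^ 2 + b ^ 2 + d ^ 2 ≤ (a + b + d) * (2 - z) := by
        nlinarith [mul_nonneg ha (by linarith : 0 ≤ 2 - z - a),
          mul_nonneg hb (by linarith : 0 ≤ 2 - z - b),
          mul_nonneg hd (by linarith : 0 ≤ 2 - z - d)]
      have hbound : (a + b + d) * (2 - z) ≤ (2 - c * z) * (2 - z) :=
        mul_le_mul_of_nonneg_right (by linarith) (by linarith)
      have hcz : 0 ≤ 1 - c * z := by nlinarith
      nlinarith [mul_nonneg hcz (sub_nonneg.2 hz1)]

/-- Containment of the rescaled Kerckhoff–Storm polytope in the model space: every nonzero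
point of the cone cut out by the 22 bounding inequalities (with `c = t|t|`,
`t ∈ (-1, 1/√3]`) has `x₀ > 0` and satisfies `q_t(x) = -x₀²+x₁²+x₂²+x₃²+c·x₄² ≤ 0`. -/
theorem polytope_contained_in_model_space (c : ℝ) (hc : c ∈ Set.Ioc (-1 : ℝ) (1 / 3))
    (x : Fin 5 → ℝ) (hx : x ≠ 0)
    (h1 : ∀ ε₁ ε₂ ε₃ : ℝ, (ε₁ = 1 ∨ ε₁ = -1) → (ε₂ = 1 ∨ ε₂ = -1) → (ε₃ = 1 ∨ ε₃ = -1) →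
      (-Real.sqrt 2 * x 0 + ε₁ * x 1 + ε₂ * x 2 + ε₃ * x 3 + ε₁ * ε₂ * ε₃ * x 4 ≤ 0 ∧
       -Real.sqrt 2 * x 0 + ε₁ * x 1 + ε₂ * x 2 + ε₃ * x 3 - ε₁ * ε₂ * ε₃ * c * x 4 ≤ 0))
    (h2 : ∀ j : Fin 5, (j = 1 ∨ j = 2 ∨ j = 3) →
      (-x 0 + Real.sqrt 2 * x j ≤ 0 ∧ -x 0 - Real.sqrt 2 * x j ≤ 0)) :
    0 < x 0 ∧ -(x 0) ^ 2 + (x 1) ^ 2 + (x 2) ^ 2 + (x 3) ^ 2 + c * (x 4) ^ 2 ≤ 0 := by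
  obtain ⟨hc1, hc2⟩ := hc
  obtain ⟨s, hs⟩ : ∃ s, x 0 = √2 * s := ⟨x 0 / √2, by field_simp⟩
  have h22 : √2 * √2 = 2 := Real.mul_self_sqrt (by norm_num)
  have hpos : 0 < √2 := by positivity
  have hcube : ∀ j : Fin 5, (j = 1 ∨ j = 2 ∨ j = 3) → x j ≤ s ∧ -s ≤ x j := by
    intro j hj
    obtain ⟨hu, hl⟩ := h2 j hj
    rw [hs] at hu hl
    constructor <;> refine le_of_mul_le_mul_left ?_ hpos <;> linarith
  obtain ⟨u1, l1⟩ := hcube 1 (by simp)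
  obtain ⟨u2, l2⟩ := hcube 2 (by simp)
  obtain ⟨u3, l3⟩ := hcube 3 (by simp)
  have h0 : -√2 * x 0 = -(2 * s) := by
    rw [hs]
    linear_combination -s * h22
  rw [h0] at h1
  obtain ⟨p1, q1⟩ := h1 1 1 1 (by simp) (by simp) (by simp)
  obtain ⟨p2, q2⟩ := h1 1 1 (-1) (by simp) (by simp) (by simp)
  obtain ⟨p3, q3⟩ := h1 1 (-1) 1 (by simp) (by simp) (by simp)
  obtain ⟨p4, q4⟩ := h1 1 (-1) (-1) (by simp) (by simp) (by simp)
  obtain ⟨p5, q5⟩ := h1 (-1) 1 1 (by simp) (by simp) (by simp)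
  obtain ⟨p6, q6⟩ := h1 (-1) 1 (-1) (by simp) (by simp) (by simp)
  obtain ⟨p7, q7⟩ := h1 (-1) (-1) 1 (by simp) (by simp) (by simp)
  obtain ⟨p8, q8⟩ := h1 (-1) (-1) (-1) (by simp) (by simp) (by simp)
  have hs0 : 0 < s := by
    by_contra! hle
    refine hx (funext fun i => ?_)
    fin_cases i <;> simp only [Pi.zero_apply, Fin.reduceFinMk, Fin.zero_eta, Fin.mk_one]
    · rw [hs, show s = 0 by linarith, mul_zero]
    all_goals linarith
  refine ⟨by rw [hs]; positivity, ?_⟩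
  obtain ⟨a, ha⟩ : ∃ a, x 1 = s * a := ⟨x 1 / s, by field_simp⟩
  obtain ⟨b, hb⟩ : ∃ b, x 2 = s * b := ⟨x 2 / s, by field_simp⟩
  obtain ⟨d, hd⟩ : ∃ d, x 3 = s * d := ⟨x 3 / s, by field_simp⟩
  obtain ⟨y, hy⟩ : ∃ y, x 4 = s * y := ⟨x 4 / s, by field_simp⟩
  simp only [ha, hb, hd, hy] at *
  have scale : ∀ {e : ℝ}, s * e ≤ 0 → e ≤ 0 := fun h => nonpos_of_mul_nonpos_right h hs0
  replace u1 : a - 1 ≤ 0 := scale (by linarith)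
  replace l1 : -a - 1 ≤ 0 := scale (by linarith)
  replace u2 : b - 1 ≤ 0 := scale (by linarith)
  replace l2 : -b - 1 ≤ 0 := scale (by linarith)
  replace u3 : d - 1 ≤ 0 := scale (by linarith)
  replace l3 : -d - 1 ≤ 0 := scale (by linarith)
  replace p1 : a + b + d + y - 2 ≤ 0 := scale (by linarith)
  replace p2 : a + b - d - y - 2 ≤ 0 := scale (by linarith)
  replace p3 : a - b + d - y - 2 ≤ 0 := scale (by linarith)
  replace p4 : a - b - d + y - 2 ≤ 0 := scale (by linarith)
  replace p5 : -a + b + d - y - 2 ≤ 0 := scale (by linarith)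
  replace p6 : -a + b - d + y - 2 ≤ 0 := scale (by linarith)
  replace p7 : -a - b + d + y - 2 ≤ 0 := scale (by linarith)
  replace p8 : -a - b - d - y - 2 ≤ 0 := scale (by linarith)
  replace q1 : a + b + d - c * y - 2 ≤ 0 := scale (by linarith)
  replace q2 : a + b - d + c * y - 2 ≤ 0 := scale (by linarith)
  replace q3 : a - b + d + c * y - 2 ≤ 0 := scale (by linarith)
  replace q4 : a - b - d - c * y - 2 ≤ 0 := scale (by linarith)
  replace q5 : -a + b + d + c * y - 2 ≤ 0 := scale (by linarith)
  replace q6 : -a + b - d - c * y - 2 ≤ 0 := scale (by linarith)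
  replace q7 : -a - b + d - c * y - 2 ≤ 0 := scale (by linarith)
  replace q8 : -a - b - d + c * y - 2 ≤ 0 := scale (by linarith)
  have key : a ^ 2 + b ^ 2 + d ^ 2 + c * y ^ 2 ≤ 2 := by
    rcases le_total 0 a with ha0 | ha0 <;> rcases le_total 0 b with hb0 | hb0 <;>
      rcases le_total 0 d with hd0 | hd0
    · exact quadratic_le_two_of_nonneg hc1 hc2 ha0 (by linarith) hb0 (by linarith) hd0
        (by linarith) (by linarith) (by linarith) (by linarith) (by linarith) (by linarith)
    · have := quadratic_le_two_of_nonneg (a := a) (b := b) (d := -d) (y := -y) hc1 hc2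
      simp only [neg_sq] at this
      apply this <;> linarith
    · have := quadratic_le_two_of_nonneg (a := a) (b := -b) (d := d) (y := -y) hc1 hc2
      simp only [neg_sq] at this
      apply this <;> linarith
    · have := quadratic_le_two_of_nonneg (a := a) (b := -b) (d := -d) (y := y) hc1 hc2
      simp only [neg_sq] at this
      apply this <;> linarith
    · have := quadratic_le_two_of_nonneg (a := -a) (b := b) (d := d) (y := -y) hc1 hc2
      simp only [neg_sq] at this
      apply this <;> linarith
    · have := quadratic_le_two_of_nonneg (a := -a) (b := b) (d := -d) (y := y) hc1 hc2
      simp only [neg_sq] at this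
      apply this <;> linarith
    · have := quadratic_le_two_of_nonneg (a := -a) (b := -b) (d := d) (y := y) hc1 hc2
      simp only [neg_sq] at this
      apply this <;> linarith
    · have := quadratic_le_two_of_nonneg (a := -a) (b := -b) (d := -d) (y := -y) hc1 hc2
      simp only [neg_sq] at this
      apply this <;> linarith
  calc -(x 0) ^ 2 + (s * a) ^ 2 + (s * b) ^ 2 + (s * d) ^ 2 + c * (s * y) ^ 2
      = s ^ 2 * (a ^ 2 + b ^ 2 + d ^ 2 + c * y ^ 2 - 2) := by
        rw [hs]
        linear_combination -s ^ 2 * h22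
    _ ≤ 0 := mul_nonpos_of_nonneg_of_nonpos (sq_nonneg s) (by linarith)
end

section
/- Let c ∈ (−1, 1/3] and let P_c ⊂ ℝ⁵ denote the set of x satisfying the 22 inequalities: for every (ε₁,ε₂,ε₃) ∈ {−1,+1}³, −√2x₀+ε₁x₁+ε₂x₂+ε₃x₃+ε₁ε₂ε₃x₄ ≤ 0 and −√2x₀+ε₁x₁+ε₂x₂+ε₃x₃−ε₁ε₂ε₃·c·x₄ ≤ 0; for every j ∈ {1,2,3}, −x₀±√2x_j ≤ 0. Let r_L, r_M, r_N, R : ℝ⁵ → ℝ⁵ be the linear maps r_L(x₀,x₁,x₂,x₃,x₄) = (x₀,x₂,x₁,x₃,x₄), r_M(x) = (x₀,x₁,x₃,x₂,x₄), r_N(x) = (x₀,x₁,−x₃,−x₂,x₄), R(x) = (x₀,x₁,x₂,−x₃,−x₄). Then: (i) each of r_L, r_M, r_N, R maps P_c bijectively onto itself; (ii) the subgroup G of GL₅(ℝ) generated by r_L, r_M, r_N is isomorphic to the symmetric group on 4 elements; (iii) for every x ∈ P_c there exists g ∈ G such that g·x satisfies the eight inequalities −√2x₀+x₁+x₂+x₃+x₄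 ≤ 0, −√2x₀+x₁+x₂−x₃−x₄ ≤ 0, −√2x₀+x₁+x₂+x₃−c·x₄ ≤ 0, −√2x₀+x₁+x₂−x₃+c·x₄ ≤ 0, −x₀+√2x₁ ≤ 0, −x₁+x₂ ≤ 0, −x₂+x₃ ≤ 0, −x₂−x₃ ≤ 0. -/
noncomputable section

/-- The cone over the rescaled Kerckhoff–Storm polytope `𝔯_{|t|}(𝒫̄_t)`, with `c = t|t|`. -/
def Pc (c : ℝ) : Set (Fin 5 → ℝ) :=
  {x | (∀ ε₁ ε₂ ε₃ : ℝ, (ε₁ = 1 ∨ ε₁ = -1) → (ε₂ = 1 ∨ ε₂ = -1) → (ε₃ = 1 ∨ ε₃ = -1) →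
          (-Real.sqrt 2 * x 0 + ε₁ * x 1 + ε₂ * x 2 + ε₃ * x 3 + ε₁ * ε₂ * ε₃ * x 4 ≤ 0 ∧
           -Real.sqrt 2 * x 0 + ε₁ * x 1 + ε₂ * x 2 + ε₃ * x 3
              - ε₁ * ε₂ * ε₃ * c * x 4 ≤ 0)) ∧
       (∀ j : Fin 5, (j = 1 ∨ j = 2 ∨ j = 3) →
          (-x 0 + Real.sqrt 2 * x j ≤ 0 ∧ -x 0 - Real.sqrt 2 * x j ≤ 0))}

/-- The linear map `r_L(x₀,x₁,x₂,x₃,x₄) = (x₀,x₂,x₁,x₃,x₄)`. -/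
def rLlin : (Fin 5 → ℝ) →ₗ[ℝ] (Fin 5 → ℝ) where
  toFun x := ![x 0, x 2, x 1, x 3, x 4]
  map_add' x y := by funext i; fin_cases i <;> simp
  map_smul' a x := by funext i; fin_cases i <;> simp

/-- The linear map `r_M(x₀,x₁,x₂,x₃,x₄) = (x₀,x₁,x₃,x₂,x₄)`. -/
def rMlin : (Fin 5 → ℝ) →ₗ[ℝ] (Fin 5 → ℝ) where
  toFun x := ![x 0, x 1, x 3, x 2, x 4]
  map_add' x y := by funext i; fin_cases i <;> simp
  map_smul' a x := by funext i; fin_cases i <;> simp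

/-- The linear map `r_N(x₀,x₁,x₂,x₃,x₄) = (x₀,x₁,-x₃,-x₂,x₄)`. -/
def rNlin : (Fin 5 → ℝ) →ₗ[ℝ] (Fin 5 → ℝ) where
  toFun x := ![x 0, x 1, -x 3, -x 2, x 4]
  map_add' x y := by funext i; fin_cases i <;> simp <;> ring
  map_smul' a x := by funext i; fin_cases i <;> simp <;> ring

/-- The linear map `R(x₀,x₁,x₂,x₃,x₄) = (x₀,x₁,x₂,-x₃,-x₄)`. -/
def Rlin : (Fin 5 → ℝ) →ₗ[ℝ] (Fin 5 → ℝ) where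
  toFun x := ![x 0, x 1, x 2, -x 3, -x 4]
  map_add' x y := by funext i; fin_cases i <;> simp <;> ring
  map_smul' a x := by funext i; fin_cases i <;> simp <;> ring

/-- `r_L` as a linear automorphism of `ℝ⁵`. -/
def rL : (Fin 5 → ℝ) ≃ₗ[ℝ] (Fin 5 → ℝ) :=
  LinearEquiv.ofLinear rLlin rLlin
    (by apply LinearMap.ext; intro x; funext i; fin_cases i <;> simp [rLlin])
    (by apply LinearMap.ext; intro x; funext i; fin_cases i <;> simp [rLlin])

/-- `r_M` as a linear automorphism of `ℝ⁵`. -/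
def rM : (Fin 5 → ℝ) ≃ₗ[ℝ] (Fin 5 → ℝ) :=
  LinearEquiv.ofLinear rMlin rMlin
    (by apply LinearMap.ext; intro x; funext i; fin_cases i <;> simp [rMlin])
    (by apply LinearMap.ext; intro x; funext i; fin_cases i <;> simp [rMlin])

/-- `r_N` as a linear automorphism of `ℝ⁵`. -/
def rN : (Fin 5 → ℝ) ≃ₗ[ℝ] (Fin 5 → ℝ) :=
  LinearEquiv.ofLinear rNlin rNlin
    (by apply LinearMap.ext; intro x; funext i; fin_cases i <;> simp [rNlin])
    (by apply LinearMap.ext; intro x; funext i; fin_cases i <;> simp [rNlin])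

/-- `R` as a linear automorphism of `ℝ⁵`. -/
def Rroll : (Fin 5 → ℝ) ≃ₗ[ℝ] (Fin 5 → ℝ) :=
  LinearEquiv.ofLinear Rlin Rlin
    (by apply LinearMap.ext; intro x; funext i; fin_cases i <;> simp [Rlin])
    (by apply LinearMap.ext; intro x; funext i; fin_cases i <;> simp [Rlin])

theorem rL_apply (x : Fin 5 → ℝ) : rL x = ![x 0, x 2, x 1, x 3, x 4] := rfl

theorem rM_apply (x : Fin 5 → ℝ) : rM x = ![x 0, x 1, x 3, x 2, x 4] := rfl

theorem rN_apply (x : Fin 5 → ℝ) : rN x = ![x 0, x 1, -x 3, -x 2, x 4] := rfl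

theorem Rroll_apply (x : Fin 5 → ℝ) : Rroll x = ![x 0, x 1, x 2, -x 3, -x 4] := rfl

/-- The change of coordinates `x ↦ ((x₀ + ⟨v, (x₁,x₂,x₃)⟩)_v, x₄)`, where `v` ranges over the four
sign vectors with product `1`. -/
def signCoords : (Fin 5 → ℝ) ≃ₗ[ℝ] (Fin 4 → ℝ) × ℝ where
  toFun x := (![x 0 + x 1 + x 2 + x 3, x 0 + x 1 - x 2 - x 3, x 0 - x 1 + x 2 - x 3,
    x 0 - x 1 - x 2 + x 3], x 4)
  invFun y := ![(y.1 0 + y.1 1 + y.1 2 + y.1 3) / 4, (y.1 0 + y.1 1 - y.1 2 - y.1 3) / 4,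
    (y.1 0 - y.1 1 + y.1 2 - y.1 3) / 4, (y.1 0 - y.1 1 - y.1 2 + y.1 3) / 4, y.2]
  map_add' x y := by
    ext i
    · fin_cases i <;> simp <;> ring
    · simp
  map_smul' a x := by
    ext i
    · fin_cases i <;> simp <;> ring
    · simp
  left_inv x := by ext i; fin_cases i <;> simp <;> ring
  right_inv y := by
    ext i
    · fin_cases i <;> simp <;> ring
    · simp

/-- The representation of the symmetric group on `ℝ⁵` that permutes the first four of the
coordinates `signCoords`. -/
def permRep : Equiv.Perm (Fin 4) →* ((Fin 5 → ℝ) ≃ₗ[ℝ] (Fin 5 → ℝ)) where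
  toFun σ := signCoords.trans
    (((LinearEquiv.funCongrLeft ℝ ℝ σ.symm).prodCongr (LinearEquiv.refl ℝ ℝ)).trans signCoords.symm)
  map_one' := by
    refine LinearEquiv.ext fun x => signCoords.injective (Prod.ext ?_ ?_)
    · ext i; simp [LinearEquiv.funCongrLeft_apply, LinearMap.funLeft_apply]; rfl
    · simp
  map_mul' σ τ := by
    refine LinearEquiv.ext fun x => signCoords.injective (Prod.ext ?_ ?_)
    · ext i; simp [LinearEquiv.funCongrLeft_apply, LinearMap.funLeft_apply]; rfl
    · simp

theorem signCoords_permRep (σ : Equiv.Perm (Fin 4)) (x : Fin 5 → ℝ) :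
    signCoords (permRep σ x) = ((signCoords x).1 ∘ σ.symm, (signCoords x).2) := by
  refine Prod.ext ?_ ?_
  · ext i; simp [permRep, LinearEquiv.funCongrLeft_apply, LinearMap.funLeft_apply]
  · simp [permRep]

theorem permRep_injective : Function.Injective permRep := by
  intro σ τ h
  refine Equiv.symm_bijective.injective (Equiv.ext fun i => ?_)
  have h' := congrArg (fun f => (signCoords (f (signCoords.symm
    (fun j : Fin 4 => ((j : ℕ) : ℝ), 0)))).1 i) h
  simp only [signCoords_permRep, LinearEquiv.apply_symm_apply, Function.comp_apply,
    Nat.cast_inj] at h'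
  exact Fin.ext h'

theorem permRep_swap_one_two : permRep (Equiv.swap 1 2) = rL := by
  refine LinearEquiv.ext fun x => signCoords.injective ?_
  rw [signCoords_permRep]
  refine Prod.ext ?_ ?_
  · ext i
    fin_cases i <;> simp [signCoords, rL_apply, Equiv.swap_apply_def] <;> ring
  · simp [signCoords, rL_apply]

theorem permRep_swap_two_three : permRep (Equiv.swap 2 3) = rM := by
  refine LinearEquiv.ext fun x => signCoords.injective ?_
  rw [signCoords_permRep]
  refine Prod.ext ?_ ?_
  · ext i
    fin_cases i <;> simp [signCoords, rM_apply, Equiv.swap_apply_def] <;> ring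
  · simp [signCoords, rM_apply]

theorem permRep_swap_zero_one : permRep (Equiv.swap 0 1) = rN := by
  refine LinearEquiv.ext fun x => signCoords.injective ?_
  rw [signCoords_permRep]
  refine Prod.ext ?_ ?_
  · ext i
    fin_cases i <;> simp [signCoords, rN_apply, Equiv.swap_apply_def] <;> ring
  · simp [signCoords, rN_apply]

theorem closure_adjacent_swaps_fin_four :
    Subgroup.closure {Equiv.swap 1 2, Equiv.swap 2 3, Equiv.swap 0 1} =
      (⊤ : Subgroup (Equiv.Perm (Fin 4))) := by
  rw [← Subgroup.toSubmonoid_inj, Subgroup.top_toSubmonoid, eq_top_iff,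
    ← Equiv.Perm.mclosure_swap_castSucc_succ 3, Submonoid.closure_le]
  rintro _ ⟨i, rfl⟩
  refine Subgroup.subset_closure ?_
  fin_cases i <;> simp

theorem range_permRep : permRep.range = Subgroup.closure {rL, rM, rN} := by
  rw [MonoidHom.range_eq_map, ← closure_adjacent_swaps_fin_four, MonoidHom.map_closure,
    Set.image_insert_eq, Set.image_insert_eq, Set.image_singleton, permRep_swap_one_two,
    permRep_swap_two_three, permRep_swap_zero_one]

theorem neg_eq_one_or_neg_one {ε : ℝ} (h : ε = 1 ∨ ε = -1) : -ε = 1 ∨ -ε = -1 := by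
  rcases h with rfl | rfl <;> simp

theorem rL_mem_Pc {c : ℝ} {x : Fin 5 → ℝ} (hx : x ∈ Pc c) : rL x ∈ Pc c := by
  refine ⟨fun a b d ha hb hd => ?_, ?_⟩
  · have h := hx.1 b a d hb ha hd
    simp only [rL_apply, Matrix.cons_val]
    constructor <;> linarith [h.1, h.2]
  · rintro j (rfl | rfl | rfl)
    · exact hx.2 2 (by simp)
    · exact hx.2 1 (by simp)
    · exact hx.2 3 (by simp)

theorem rM_mem_Pc {c : ℝ} {x : Fin 5 → ℝ} (hx : x ∈ Pc c) : rM x ∈ Pc c := by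
  refine ⟨fun a b d ha hb hd => ?_, ?_⟩
  · have h := hx.1 a d b ha hd hb
    simp only [rM_apply, Matrix.cons_val]
    constructor <;> linarith [h.1, h.2]
  · rintro j (rfl | rfl | rfl)
    · exact hx.2 1 (by simp)
    · exact hx.2 3 (by simp)
    · exact hx.2 2 (by simp)

theorem rN_mem_Pc {c : ℝ} {x : Fin 5 → ℝ} (hx : x ∈ Pc c) : rN x ∈ Pc c := by
  have h1 := hx.2 1 (by simp)
  have h2 := hx.2 2 (by simp)
  have h3 := hx.2 3 (by simp)
  refine ⟨fun a b d ha hb hd => ?_, ?_⟩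
  · have h := hx.1 a (-d) (-b) ha (neg_eq_one_or_neg_one hd) (neg_eq_one_or_neg_one hb)
    simp only [rN_apply, Matrix.cons_val]
    constructor <;> linarith [h.1, h.2]
  · rintro j (rfl | rfl | rfl) <;>
    · simp only [rN_apply, Matrix.cons_val]
      constructor <;> linarith

theorem Rroll_mem_Pc {c : ℝ} {x : Fin 5 → ℝ} (hx : x ∈ Pc c) : Rroll x ∈ Pc c := by
  have h1 := hx.2 1 (by simp)
  have h2 := hx.2 2 (by simp)
  have h3 := hx.2 3 (by simp)
  refine ⟨fun a b d ha hb hd => ?_, ?_⟩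
  · have h := hx.1 a b (-d) ha hb (neg_eq_one_or_neg_one hd)
    simp only [Rroll_apply, Matrix.cons_val]
    constructor <;> linarith [h.1, h.2]
  · rintro j (rfl | rfl | rfl) <;>
    · simp only [Rroll_apply, Matrix.cons_val]
      constructor <;> linarith

theorem Function.Involutive.bijOn {α : Type*} {f : α → α} (hf : Function.Involutive f) {s : Set α}
    (hs : ∀ x ∈ s, f x ∈ s) : Set.BijOn f s s :=
  ⟨hs, hf.injective.injOn, fun x hx => ⟨f x, hs x hx, hf x⟩⟩

theorem bijOn_of_mem_closure {c : ℝ} {g : (Fin 5 → ℝ) ≃ₗ[ℝ] (Fin 5 → ℝ)}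
    (hg : g ∈ Subgroup.closure {rL, rM, rN}) : Set.BijOn g (Pc c) (Pc c) := by
  induction hg using Subgroup.closure_induction with
  | mem g hg =>
    rcases hg with rfl | rfl | rfl
    · exact Function.Involutive.bijOn rL.left_inv fun _ => rL_mem_Pc
    · exact Function.Involutive.bijOn rM.left_inv fun _ => rM_mem_Pc
    · exact Function.Involutive.bijOn rN.left_inv fun _ => rN_mem_Pc
  | one => exact Set.bijOn_id _
  | mul g h _ _ hg hh => exact hg.comp hh
  | inv g _ hg => exact hg.symm ⟨fun x _ => g.right_inv x, fun x _ => g.left_inv x⟩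

theorem exists_permRep_antitone (x : Fin 5 → ℝ) :
    ∃ σ, Antitone (signCoords (permRep σ x)).1 := by
  refine ⟨(Tuple.sort (-(signCoords x).1)).symm, fun i j hij => ?_⟩
  have h := Tuple.monotone_sort (-(signCoords x).1) hij
  simpa [signCoords_permRep] using h

/-- The symmetries of the Kerckhoff–Storm polytope: `r_L, r_M, r_N, R` preserve the
polytope; the group generated by `r_L, r_M, r_N` is isomorphic to `𝔖₄`; and the
domain cut out by the eight inequalities of `𝒬̄` is a fundamental domain for its action. -/
theorem polytope_symmetries (c : ℝ) (hc : c ∈ Set.Ioc (-1 : ℝ) (1 / 3)) :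
    (Set.BijOn rL (Pc c) (Pc c) ∧ Set.BijOn rM (Pc c) (Pc c) ∧
      Set.BijOn rN (Pc c) (Pc c) ∧ Set.BijOn Rroll (Pc c) (Pc c)) ∧
    Nonempty ((Subgroup.closure {rL, rM, rN} :
        Subgroup ((Fin 5 → ℝ) ≃ₗ[ℝ] (Fin 5 → ℝ))) ≃* Equiv.Perm (Fin 4)) ∧
    (∀ x ∈ Pc c, ∃ g ∈ Subgroup.closure ({rL, rM, rN} :
        Set ((Fin 5 → ℝ) ≃ₗ[ℝ] (Fin 5 → ℝ))),
      -Real.sqrt 2 * (g x) 0 + (g x) 1 + (g x) 2 + (g x) 3 + (g x) 4 ≤ 0 ∧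
      -Real.sqrt 2 * (g x) 0 + (g x) 1 + (g x) 2 - (g x) 3 - (g x) 4 ≤ 0 ∧
      -Real.sqrt 2 * (g x) 0 + (g x) 1 + (g x) 2 + (g x) 3 - c * (g x) 4 ≤ 0 ∧
      -Real.sqrt 2 * (g x) 0 + (g x) 1 + (g x) 2 - (g x) 3 + c * (g x) 4 ≤ 0 ∧
      -(g x) 0 + Real.sqrt 2 * (g x) 1 ≤ 0 ∧
      -(g x) 1 + (g x) 2 ≤ 0 ∧
      -(g x) 2 + (g x) 3 ≤ 0 ∧
      -(g x) 2 - (g x) 3 ≤ 0) := by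
  have mem_L : rL ∈ Subgroup.closure {rL, rM, rN} := Subgroup.subset_closure (by simp)
  have mem_M : rM ∈ Subgroup.closure {rL, rM, rN} := Subgroup.subset_closure (by simp)
  have mem_N : rN ∈ Subgroup.closure {rL, rM, rN} := Subgroup.subset_closure (by simp)
  refine ⟨⟨bijOn_of_mem_closure mem_L, bijOn_of_mem_closure mem_M, bijOn_of_mem_closure mem_N,
    Function.Involutive.bijOn Rroll.left_inv fun _ => Rroll_mem_Pc⟩, ?_, fun x hx => ?_⟩
  · rw [← range_permRep]
    exact ⟨(MonoidHom.ofInjective permRep_injective).symm⟩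
  · obtain ⟨σ, hσ⟩ := exists_permRep_antitone x
    have hg : permRep σ ∈ Subgroup.closure {rL, rM, rN} := range_permRep ▸ ⟨σ, rfl⟩
    have hy : permRep σ x ∈ Pc c := (bijOn_of_mem_closure hg).mapsTo hx
    refine ⟨permRep σ, hg, ?_⟩
    generalize permRep σ x = y at hσ hy
    have h := hy.1 1 1 1 (by simp) (by simp) (by simp)
    have h' := hy.1 1 1 (-1) (by simp) (by simp) (by simp)
    have h01 := hσ (show (0 : Fin 4) ≤ 1 by decide)
    have h12 := hσ (show (1 : Fin 4) ≤ 2 by decide)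
    have h23 := hσ (show (2 : Fin 4) ≤ 3 by decide)
    simp only [signCoords, LinearEquiv.coe_mk, LinearMap.coe_mk, AddHom.coe_mk,
      Matrix.cons_val] at h01 h12 h23
    refine ⟨?_, ?_, ?_, ?_, (hy.2 1 (by simp)).1, ?_, ?_, ?_⟩ <;>
      linarith [h.1, h.2, h'.1, h'.2]
end
end
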